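/- arXiv:1302.4007 — 7 statements merged into one kernel-verified Lean document; each statement's English description precedes it below -/
import Mathlib

section
/- Let q0, q1, q2 be the vertices of an equilateral triangle in the plane, and for j = 0,1,2 let Φ_j(x) = (x − q_j)/2 + q_j. Define inductively V_0 = {q0, q1, q2} and V_m = Φ_0(V_{m−1}) ∪ Φ_1(V_{m−1}) ∪ Φ_2(V_{m−1}) for m ≥ 1. Declare two distinct points x, y of V_m adjacent (x ∼ y in Γ_m) if there is a word (i_1, …, i_m) ∈ {0,1,2}^m with x, y ∈ Φ_{i_1} ∘ ⋯ ∘ Φ_{i_m}(V_0), and for x ∈ V_m \ V_0 set Δ_m f(x) = (1/4) Σ_{y ∼ x} (f(y) − f(x)). Then for every m ≥ 0 and every λ ∈ ℂ with λ ∉ {1/2, 5/4, 3/2}: if u : V_{m+1} → ℝ satisfies −Δ_{m+1} u(x) = λ u(x) for all x ∈ V_{m+1} \ V_0, then the restriction u|_{V_m} satisfies −Δ_m (u|_{V_m})(x) = R(λ) u(x) for all x ∈ V_m \ V_0, where R(λ) = λ(5 − 4λ). -/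
open Filter

noncomputable section

/-- The plane. -/
abbrev Plane := EuclideanSpace ℝ (Fin 2)

/-- The contraction `Φ_j(x) = (x - q_j)/2 + q_j`. -/
def SGmap (q : Fin 3 → Plane) (j : Fin 3) (x : Plane) : Plane :=
  (1 / 2 : ℝ) • (x - q j) + q j

/-- The level-`m` vertex set `V_m` of the Sierpinski gasket approximation. -/
def SGvert (q : Fin 3 → Plane) : ℕ → Set Plane
  | 0 => {q 0, q 1, q 2}
  | m + 1 => SGmap q 0 '' SGvert q m ∪ SGmap q 1 '' SGvert q m ∪ SGmap q 2 '' SGvert q m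

/-- The composition `Φ_{i₁} ∘ ⋯ ∘ Φ_{iₘ}` associated to a word `(i₁, …, iₘ)`. -/
def SGword (q : Fin 3 → Plane) : List (Fin 3) → Plane → Plane
  | [] => id
  | j :: w => SGmap q j ∘ SGword q w

/-- Adjacency in the graph `Γ_m`: two distinct points of `V_m` lying in a common cell
`Φ_{i₁} ∘ ⋯ ∘ Φ_{iₘ}(V_0)`. -/
def SGadj (q : Fin 3 → Plane) (m : ℕ) (x y : Plane) : Prop :=
  x ∈ SGvert q m ∧ y ∈ SGvert q m ∧ x ≠ y ∧
    ∃ w : List (Fin 3), w.length = m ∧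
      x ∈ SGword q w '' SGvert q 0 ∧ y ∈ SGword q w '' SGvert q 0

/-- The discrete graph Laplacian `Δ_m f(x) = (1/4) Σ_{y ∼ x} (f(y) - f(x))`. -/
def SGlap (q : Fin 3 → Plane) (m : ℕ) (f : Plane → ℝ) (x : Plane) : ℝ :=
  (1 / 4 : ℝ) * ∑ᶠ y ∈ {y | SGadj q m x y}, (f y - f x)

/-- The hypothesis that the triangle is equilateral. -/
def SGequi (q : Fin 3 → Plane) : Prop :=
  ∃ r : ℝ, 0 < r ∧ ∀ i j : Fin 3, i ≠ j → dist (q i) (q j) = r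

lemma sg_q_inj {q : Fin 3 → Plane} (hq : SGequi q) {i j : Fin 3} (h : q i = q j) : i = j := by
  obtain ⟨r, hr, hd⟩ := hq
  by_contra hne
  have := hd i j hne
  rw [h, dist_self] at this
  linarith

lemma sg_dist_sq (x y : Plane) : dist x y ^ 2 = (x 0 - y 0) ^ 2 + (x 1 - y 1) ^ 2 := by
  rw [EuclideanSpace.dist_eq, Real.sq_sqrt (by positivity)]
  simp [Fin.sum_univ_two, Real.dist_eq, sq_abs]

lemma sg_bary {q : Fin 3 → Plane} (hq : SGequi q) : ∃ b : Fin 3 → Plane → ℝ,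
    (∀ i j, b i (q j) = if i = j then 1 else 0) ∧
    ∀ i j x, b i (SGmap q j x) = (b i x + if i = j then 1 else 0) / 2 := by
  obtain ⟨r, hr, hd⟩ := hq
  have hr2 : r ^ 2 ≠ 0 := by positivity
  let b : Fin 3 → Plane → ℝ := fun k x => 1 / 3 +
    (dist x (q 0) ^ 2 + dist x (q 1) ^ 2 + dist x (q 2) ^ 2 - 3 * dist x (q k) ^ 2) / (3 * r ^ 2)
  have hb : ∀ i j, b i (q j) = if i = j then 1 else 0 := by
    intro i j
    have e : ∀ a c : Fin 3, dist (q a) (q c) = if a = c then 0 else r := by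
      intro a c
      split_ifs with h
      · rw [h, dist_self]
      · exact hd a c h
    simp only [b, e]
    fin_cases i <;> fin_cases j <;> simp <;> field_simp <;> norm_num
  refine ⟨b, hb, ?_⟩
  intro i j x
  rw [← hb i j]
  simp only [b, sg_dist_sq, SGmap, PiLp.add_apply, PiLp.smul_apply, PiLp.sub_apply, smul_eq_mul]
  field_simp
  fin_cases i <;> simp <;> ring

lemma sg_mem0 {q : Fin 3 → Plane} {x : Plane} : x ∈ SGvert q 0 ↔ ∃ i, x = q i := by
  simp [SGvert, Fin.exists_fin_succ]

lemma sg_mem_succ {q : Fin 3 → Plane} {m : ℕ} {x : Plane} :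
    x ∈ SGvert q (m + 1) ↔ ∃ j, ∃ y ∈ SGvert q m, x = SGmap q j y := by
  simp [SGvert, Fin.exists_fin_succ, or_assoc, eq_comm]

lemma sg_map_self (q : Fin 3 → Plane) (j : Fin 3) : SGmap q j (q j) = q j := by
  simp [SGmap]

lemma sg_map_swap (q : Fin 3 → Plane) (j k : Fin 3) :
    SGmap q j (q k) = SGmap q k (q j) := by
  ext t
  simp [SGmap]
  ring

lemma sg_map_inj {q : Fin 3 → Plane} {j : Fin 3} {x y : Plane}
    (h : SGmap q j x = SGmap q j y) : x = y := by
  simpa [SGmap] using h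

lemma sg_word_inj {q : Fin 3 → Plane} (w : List (Fin 3)) {x y : Plane}
    (h : SGword q w x = SGword q w y) : x = y := by
  induction w with
  | nil => simpa [SGword] using h
  | cons j w ih => exact ih (sg_map_inj h)

lemma sg_word_append (q : Fin 3 → Plane) (w : List (Fin 3)) (j : Fin 3) (x : Plane) :
    SGword q (w ++ [j]) x = SGword q w (SGmap q j x) := by
  induction w with
  | nil => rfl
  | cons k w ih => simp only [List.cons_append, SGword, Function.comp_apply, ih]

lemma sg_word_mem (q : Fin 3 → Plane) (w : List (Fin 3)) (i : Fin 3) :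
    SGword q w (q i) ∈ SGvert q w.length := by
  induction w with
  | nil => exact sg_mem0.2 ⟨i, rfl⟩
  | cons j w ih => exact sg_mem_succ.2 ⟨j, _, ih, rfl⟩

lemma sg_key {q : Fin 3 → Plane} (hq : SGequi q) {m : ℕ} {j k : Fin 3} (hjk : j ≠ k)
    {x y : Plane} (hx : x ∈ SGvert q m) (hy : y ∈ SGvert q m)
    (h : SGmap q j x = SGmap q k y) : x = q k ∧ y = q j := by
  obtain ⟨b, hb, hm⟩ := sg_bary hq
  have H : ∀ m, ∀ x ∈ SGvert q m, (∀ i, 0 ≤ b i x) ∧ b 0 x + b 1 x + b 2 x = 1 ∧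
      x = b 0 x • q 0 + b 1 x • q 1 + b 2 x • q 2 := by
    intro m
    induction m with
    | zero =>
      intro x hx
      obtain ⟨i, rfl⟩ := sg_mem0.1 hx
      refine ⟨fun a => ?_, ?_, ?_⟩
      · rw [hb]; split_ifs <;> norm_num
      · simp only [hb]; fin_cases i <;> simp
      · simp only [hb]; fin_cases i <;> simp
    | succ m ih =>
      intro x hx
      obtain ⟨i, y, hy, rfl⟩ := sg_mem_succ.1 hx
      obtain ⟨h0, h1, h2⟩ := ih y hy
      refine ⟨fun a => ?_, ?_, ?_⟩
      · rw [hm]; have := h0 a; split_ifs <;> linarith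
      · simp only [hm]; fin_cases i <;> simp <;> linarith
      · simp only [hm]
        generalize b 0 y = b0 at *
        generalize b 1 y = b1 at *
        generalize b 2 y = b2 at *
        subst h2
        ext t
        fin_cases i <;> simp [SGmap] <;> ring
  obtain ⟨x0, x1, x2⟩ := H m x hx
  obtain ⟨y0, y1, y2⟩ := H m y hy
  have e1 : b k x = b k y + 1 := by
    have := congrArg (b k) h
    rw [hm, hm, if_neg hjk.symm, if_pos rfl] at this
    linarith
  have e2 : b j x + 1 = b j y := by
    have := congrArg (b j) h
    rw [hm, hm, if_neg hjk, if_pos rfl] at this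
    linarith
  have F : ∀ (z : Plane) (k : Fin 3), (∀ i, 0 ≤ b i z) → b 0 z + b 1 z + b 2 z = 1 →
      z = b 0 z • q 0 + b 1 z • q 1 + b 2 z • q 2 → 1 ≤ b k z → z = q k := by
    intro z k h0 h1 h2 h3
    have a0 := h0 0
    have a1 := h0 1
    have a2 := h0 2
    fin_cases k <;> simp at h3 ⊢
    · have c0 : b 0 z = 1 := by linarith
      have c1 : b 1 z = 0 := by linarith
      have c2 : b 2 z = 0 := by linarith
      rw [h2, c0, c1, c2]; simp
    · have c0 : b 0 z = 0 := by linarith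
      have c1 : b 1 z = 1 := by linarith
      have c2 : b 2 z = 0 := by linarith
      rw [h2, c0, c1, c2]; simp
    · have c0 : b 0 z = 0 := by linarith
      have c1 : b 1 z = 0 := by linarith
      have c2 : b 2 z = 1 := by linarith
      rw [h2, c0, c1, c2]; simp
  exact ⟨F x k x0 x1 x2 (by linarith [y0 k]), F y j y0 y1 y2 (by linarith [x0 j])⟩

/-- Key lemma for words. -/
lemma sg_keyw {q : Fin 3 → Plane} (hq : SGequi q) {j k : Fin 3} (hjk : j ≠ k)
    {w v : List (Fin 3)} (hl : w.length = v.length) {a c : Fin 3}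
    (h : SGmap q j (SGword q w (q a)) = SGmap q k (SGword q v (q c))) :
    SGword q w (q a) = q k ∧ SGword q v (q c) = q j :=
  sg_key hq hjk (sg_word_mem q w a) (hl ▸ sg_word_mem q v c) h

lemma sg_corner {q : Fin 3 → Plane} (hq : SGequi q) (w : List (Fin 3)) (i k : Fin 3)
    (h : SGword q w (q i) = q k) : w = List.replicate w.length k := by
  induction w with
  | nil => rfl
  | cons j w ih =>
    have h' : SGmap q j (SGword q w (q i)) = q k := h
    by_cases hjk : j = k
    · subst hjk
      rw [← sg_map_self q j] at h'
      have := ih (sg_map_inj h')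
      rw [List.length_cons, List.replicate_succ, ← this]
    · exfalso
      have hk : q k ∈ SGvert q w.length := by
        have : ∀ n, q k ∈ SGvert q n := by
          intro n
          induction n with
          | zero => exact sg_mem0.2 ⟨k, rfl⟩
          | succ n ih => exact sg_mem_succ.2 ⟨k, _, ih, (sg_map_self q k).symm⟩
        exact this _
      rw [← sg_map_self q k] at h'
      have := (sg_key hq hjk (sg_word_mem q w i) hk h').2
      exact hjk (sg_q_inj hq this).symm

lemma sg_corner2 {q : Fin 3 → Plane} (hq : SGequi q) {w v : List (Fin 3)}
    (hl : w.length = v.length) {i j k : Fin 3}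
    (h : SGword q w (q i) = q k) (h' : SGword q v (q j) = q k) : w = v := by
  rw [sg_corner hq w i k h, sg_corner hq v j k h', hl]

/-- A point lies in at most two cells. -/
lemma sg_three {q : Fin 3 → Plane} (hq : SGequi q) (n : ℕ) :
    ∀ (w1 w2 w3 : List (Fin 3)) (i1 i2 i3 : Fin 3), w1.length = n → w2.length = n →
      w3.length = n → SGword q w1 (q i1) = SGword q w2 (q i2) →
      SGword q w1 (q i1) = SGword q w3 (q i3) → w1 ≠ w2 → w3 = w1 ∨ w3 = w2 := by
  induction n with
  | zero =>
    intro w1 w2 w3 i1 i2 i3 h1 h2 h3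
    simp at h1 h2 h3
    subst h1 h2 h3
    simp
  | succ n ih =>
    intro w1 w2 w3 i1 i2 i3 h1 h2 h3 e2 e3 hne
    obtain ⟨j1, v1, rfl⟩ := List.exists_cons_of_length_eq_add_one h1
    obtain ⟨j2, v2, rfl⟩ := List.exists_cons_of_length_eq_add_one h2
    obtain ⟨j3, v3, rfl⟩ := List.exists_cons_of_length_eq_add_one h3
    simp only [List.length_cons, Nat.add_right_cancel_iff] at h1 h2 h3
    have e2' : SGmap q j1 (SGword q v1 (q i1)) = SGmap q j2 (SGword q v2 (q i2)) := e2
    have e3' : SGmap q j1 (SGword q v1 (q i1)) = SGmap q j3 (SGword q v3 (q i3)) := e3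
    have e4' := e2'.symm.trans e3'
    by_cases c12 : j1 = j2
    · subst c12
      by_cases c13 : j1 = j3
      · subst c13
        have := ih v1 v2 v3 i1 i2 i3 h1 h2 h3 (sg_map_inj e2') (sg_map_inj e3')
          (fun h => hne (by rw [h]))
        simpa using this
      · have a := sg_keyw hq c13 (h1.trans h3.symm) e3'
        have c := sg_keyw hq c13 (h2.trans h3.symm) e4'
        exact absurd (by rw [sg_corner2 hq (h1.trans h2.symm) a.1 c.1]) hne
    · have a := sg_keyw hq c12 (h1.trans h2.symm) e2'
      by_cases c13 : j1 = j3
      · subst c13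
        have c := sg_map_inj e3'
        left
        rw [sg_corner2 hq (h3.trans h1.symm) (c.symm.trans a.1) a.1]
      · have c := sg_keyw hq c13 (h1.trans h3.symm) e3'
        have := sg_q_inj hq (a.1.symm.trans c.1)
        subst this
        right
        rw [sg_corner2 hq (h3.trans h2.symm) c.2 a.2]

/-- Two distinct cells share at most one point. -/
lemma sg_inter {q : Fin 3 → Plane} (hq : SGequi q) (n : ℕ) :
    ∀ (w1 w2 : List (Fin 3)) (a c b d : Fin 3), w1.length = n → w2.length = n → w1 ≠ w2 →
      SGword q w1 (q a) = SGword q w2 (q b) → SGword q w1 (q c) = SGword q w2 (q d) → a = c := by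
  induction n with
  | zero =>
    intro w1 w2 a c b d h1 h2
    simp at h1 h2
    subst h1 h2
    simp
  | succ n ih =>
    intro w1 w2 a c b d h1 h2 hne e f
    obtain ⟨j1, v1, rfl⟩ := List.exists_cons_of_length_eq_add_one h1
    obtain ⟨j2, v2, rfl⟩ := List.exists_cons_of_length_eq_add_one h2
    simp only [List.length_cons, Nat.add_right_cancel_iff] at h1 h2
    have e' : SGmap q j1 (SGword q v1 (q a)) = SGmap q j2 (SGword q v2 (q b)) := e
    have f' : SGmap q j1 (SGword q v1 (q c)) = SGmap q j2 (SGword q v2 (q d)) := f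
    by_cases c12 : j1 = j2
    · subst c12
      exact ih v1 v2 a c b d h1 h2 (fun h => hne (by rw [h])) (sg_map_inj e') (sg_map_inj f')
    · have x := sg_keyw hq c12 (h1.trans h2.symm) e'
      have y := sg_keyw hq c12 (h1.trans h2.symm) f'
      exact sg_q_inj hq (sg_word_inj v1 (x.1.trans y.1.symm))

lemma sg_replicate (q : Fin 3 → Plane) (n : ℕ) (k : Fin 3) :
    SGword q (List.replicate n k) (q k) = q k := by
  induction n with
  | zero => rfl
  | succ n ih =>
    rw [List.replicate_succ]
    change SGmap q k (SGword q (List.replicate n k) (q k)) = q k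
    rw [ih, sg_map_self]

/-- An interior vertex lies in two distinct cells. -/
lemma sg_exists (q : Fin 3 → Plane) (n : ℕ) :
    ∀ x ∈ SGvert q n \ SGvert q 0, ∃ (w1 w2 : List (Fin 3)) (i1 i2 : Fin 3),
      w1.length = n ∧ w2.length = n ∧ w1 ≠ w2 ∧ x = SGword q w1 (q i1) ∧
      x = SGword q w2 (q i2) := by
  induction n with
  | zero => intro x hx; exact absurd hx.1 hx.2
  | succ n ih =>
    rintro x ⟨hx, hx0⟩
    obtain ⟨j, y, hy, rfl⟩ := sg_mem_succ.1 hx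
    by_cases hy0 : y ∈ SGvert q 0
    · obtain ⟨k, rfl⟩ := sg_mem0.1 hy0
      have hjk : j ≠ k := by
        rintro rfl
        exact hx0 (by rw [sg_map_self]; exact hy0)
      refine ⟨j :: List.replicate n k, k :: List.replicate n j, k, j, by simp, by simp, ?_, ?_, ?_⟩
      · intro h
        exact hjk (List.cons.inj h).1
      · change _ = SGmap q j (SGword q _ _)
        rw [sg_replicate]
      · change _ = SGmap q k (SGword q _ _)
        rw [sg_replicate, sg_map_swap]
    · obtain ⟨w1, w2, i1, i2, h1, h2, hne, e1, e2⟩ := ih y ⟨hy, hy0⟩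
      refine ⟨j :: w1, j :: w2, i1, i2, by simp [h1], by simp [h2], by simpa using hne, ?_, ?_⟩
      · exact congrArg (SGmap q j) e1
      · exact congrArg (SGmap q j) e2

/-- The Laplacian in terms of the two cells containing the point. -/
lemma sg_lap {q : Fin 3 → Plane} (hq : SGequi q) {n : ℕ} {w1 w2 : List (Fin 3)} {i1 i2 : Fin 3}
    {x : Plane} (h1 : w1.length = n) (h2 : w2.length = n) (hne : w1 ≠ w2)
    (e1 : x = SGword q w1 (q i1)) (e2 : x = SGword q w2 (q i2)) (u : Plane → ℝ) :
    SGlap q n u x = (1 / 4) * ((∑ j, u (SGword q w1 (q j))) +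
      (∑ j, u (SGword q w2 (q j))) - 6 * u x) := by
  classical
  let f1 : Fin 3 → Plane := fun j => SGword q w1 (q j)
  let f2 : Fin 3 → Plane := fun j => SGword q w2 (q j)
  have inj1 : Function.Injective f1 := fun a b h => sg_q_inj hq (sg_word_inj w1 h)
  have inj2 : Function.Injective f2 := fun a b h => sg_q_inj hq (sg_word_inj w2 h)
  let s1 := (Finset.univ.erase i1).image f1
  let s2 := (Finset.univ.erase i2).image f2
  have hset : {y | SGadj q n x y} = ((s1 ∪ s2 : Finset Plane) : Set Plane) := by
    ext y
    simp only [Set.mem_ofPred_eq, Finset.mem_coe, Finset.mem_union, s1, s2, Finset.mem_image,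
      Finset.mem_erase, Finset.mem_univ, and_true]
    constructor
    · rintro ⟨-, -, hxy, w, hw, ⟨p, hp, hpx⟩, ⟨p', hp', hpy⟩⟩
      obtain ⟨a, rfl⟩ := sg_mem0.1 hp
      obtain ⟨c, rfl⟩ := sg_mem0.1 hp'
      rcases sg_three hq n w1 w2 w i1 i2 a h1 h2 hw (e1.symm.trans e2)
        (e1.symm.trans hpx.symm) hne with rfl | rfl
      · left
        refine ⟨c, ?_, hpy⟩
        rintro rfl
        exact hxy (e1.trans hpy)
      · right
        refine ⟨c, ?_, hpy⟩
        rintro rfl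
        exact hxy (e2.trans hpy)
    · rintro (⟨c, hc, rfl⟩ | ⟨c, hc, rfl⟩)
      · refine ⟨?_, ?_, ?_, w1, h1, ?_, ?_⟩
        · rw [e1, ← h1]; exact sg_word_mem q w1 i1
        · rw [← h1]; exact sg_word_mem q w1 c
        · intro h
          exact hc (inj1 (h.symm.trans e1))
        · exact ⟨q i1, sg_mem0.2 ⟨_, rfl⟩, e1.symm⟩
        · exact ⟨q c, sg_mem0.2 ⟨_, rfl⟩, rfl⟩
      · refine ⟨?_, ?_, ?_, w2, h2, ?_, ?_⟩
        · rw [e2, ← h2]; exact sg_word_mem q w2 i2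
        · rw [← h2]; exact sg_word_mem q w2 c
        · intro h
          exact hc (inj2 (h.symm.trans e2))
        · exact ⟨q i2, sg_mem0.2 ⟨_, rfl⟩, e2.symm⟩
        · exact ⟨q c, sg_mem0.2 ⟨_, rfl⟩, rfl⟩
  have hdisj : Disjoint s1 s2 := by
    rw [Finset.disjoint_left]
    intro y hy1 hy2
    simp only [s1, s2, Finset.mem_image, Finset.mem_erase, Finset.mem_univ, and_true] at hy1 hy2
    obtain ⟨c, hc, rfl⟩ := hy1
    obtain ⟨d, hd, h⟩ := hy2
    exact hc (sg_inter hq n w1 w2 i1 c i2 d h1 h2 hne (e1.symm.trans e2) h.symm).symm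
  unfold SGlap
  rw [hset, finsum_mem_coe_finset, Finset.sum_union hdisj,
    Finset.sum_image (fun a _ b _ h => inj1 h), Finset.sum_image (fun a _ b _ h => inj2 h)]
  have t1 := Finset.add_sum_erase Finset.univ (fun j => u (f1 j) - u x) (Finset.mem_univ i1)
  have t2 := Finset.add_sum_erase Finset.univ (fun j => u (f2 j) - u x) (Finset.mem_univ i2)
  have z1 : u (f1 i1) - u x = 0 := by rw [e1]; simp [f1]
  have z2 : u (f2 i2) - u x = 0 := by rw [e2]; simp [f2]
  simp only [z1, z2, zero_add] at t1 t2
  rw [t1, t2]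
  simp only [Finset.sum_sub_distrib, Finset.sum_const, Finset.card_univ, Fintype.card_fin, f1, f2]
  simp
  ring

/-- Consequence of the eigenvalue equation at the three midpoints of a cell. -/
lemma sg_cell {q : Fin 3 → Plane} (hq : SGequi q) (m : ℕ) (lam : ℂ) (u : Plane → ℝ)
    (hu : ∀ x ∈ SGvert q (m + 1) \ SGvert q 0,
      (-(SGlap q (m + 1) u x) : ℂ) = lam * (u x : ℂ))
    (w : List (Fin 3)) (hw : w.length = m) (i : Fin 3) :
    (5 - 4 * lam) * (1 - 2 * lam) * ∑ j, (u (SGword q (w ++ [i]) (q j)) : ℂ) =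
      ((5 - 4 * lam) * (1 - 2 * lam) + (1 - 2 * lam)) * u (SGword q w (q i)) +
      ((1 - 2 * lam) + 2) * ∑ j, (u (SGword q w (q j)) : ℂ) := by
  have hmid : ∀ a c : Fin 3, a ≠ c →
      (6 - 4 * lam) * (u (SGword q w (SGmap q a (q c))) : ℂ) =
        ∑ j, (u (SGword q w (SGmap q a (q j))) : ℂ) +
        ∑ j, (u (SGword q w (SGmap q c (q j))) : ℂ) := by
    intro a c hac
    have la : (w ++ [a]).length = m + 1 := by simp [hw]
    have lc : (w ++ [c]).length = m + 1 := by simp [hw]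
    have hne : w ++ [a] ≠ w ++ [c] := by simpa using hac
    have ea : SGword q w (SGmap q a (q c)) = SGword q (w ++ [a]) (q c) :=
      (sg_word_append q w a _).symm
    have ec : SGword q w (SGmap q a (q c)) = SGword q (w ++ [c]) (q a) := by
      rw [sg_word_append, sg_map_swap]
    have hmem : SGword q w (SGmap q a (q c)) ∈ SGvert q (m + 1) \ SGvert q 0 := by
      constructor
      · rw [ea, ← la]; exact sg_word_mem q _ _
      · intro h
        obtain ⟨k, hk⟩ := sg_mem0.1 h
        exact hne (sg_corner2 hq (la.trans lc.symm) (ea.symm.trans hk) (ec.symm.trans hk))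
    have h := hu _ hmem
    rw [sg_lap hq la lc hne ea ec u] at h
    simp only [sg_word_append] at h
    push_cast at h
    linear_combination 4 * h
  have m01 := hmid 0 1 (by decide)
  have m02 := hmid 0 2 (by decide)
  have m12 := hmid 1 2 (by decide)
  simp only [sg_word_append]
  simp only [Fin.sum_univ_three, sg_map_self, sg_map_swap q 1 0, sg_map_swap q 2 0,
    sg_map_swap q 2 1] at m01 m02 m12 ⊢
  fin_cases i <;> simp [sg_map_self, sg_map_swap q 1 0, sg_map_swap q 2 0,
    sg_map_swap q 2 1]
  · linear_combination (1 - 2 * lam) * (m01 + m02) + (m01 + m02 + m12)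
  · linear_combination (1 - 2 * lam) * (m01 + m12) + (m01 + m02 + m12)
  · linear_combination (1 - 2 * lam) * (m02 + m12) + (m01 + m02 + m12)

/-- Part (i) of the decimation theorem of Fukushima and Shima: if `-Δ_{m+1} u = λ u`
(away from `V_0`) and `λ` is not a forbidden eigenvalue, then
`-Δ_m (u|_{V_m}) = R(λ) u|_{V_m}` with `R(λ) = λ(5 - 4λ)`. -/
theorem decimation_part_one
    (q : Fin 3 → Plane)
    (hq : ∃ r : ℝ, 0 < r ∧ ∀ i j : Fin 3, i ≠ j → dist (q i) (q j) = r)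
    (m : ℕ) (lam : ℂ) (hlam : lam ∉ ({1 / 2, 5 / 4, 3 / 2} : Set ℂ))
    (u : Plane → ℝ)
    (hu : ∀ x ∈ SGvert q (m + 1) \ SGvert q 0,
      (-(SGlap q (m + 1) u x) : ℂ) = lam * (u x : ℂ)) :
    ∀ x ∈ SGvert q m \ SGvert q 0,
      (-(SGlap q m u x) : ℂ) = lam * (5 - 4 * lam) * (u x : ℂ) := by
  intro x hx
  obtain ⟨w1, w2, i1, i2, h1, h2, hne, e1, e2⟩ := sg_exists q m x hx
  have a1 : (w1 ++ [i1]).length = m + 1 := by simp [h1]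
  have a2 : (w2 ++ [i2]).length = m + 1 := by simp [h2]
  have f1 : x = SGword q (w1 ++ [i1]) (q i1) := by rw [sg_word_append, sg_map_self, e1]
  have f2 : x = SGword q (w2 ++ [i2]) (q i2) := by rw [sg_word_append, sg_map_self, ← e2]
  have hne' : w1 ++ [i1] ≠ w2 ++ [i2] := fun h =>
    hne (List.append_inj_left h (h1.trans h2.symm))
  have hmem : x ∈ SGvert q (m + 1) \ SGvert q 0 := by
    refine ⟨?_, hx.2⟩
    rw [f1, ← a1]
    exact sg_word_mem q _ _
  have E := hu x hmem
  rw [sg_lap hq a1 a2 hne' f1 f2 u] at E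
  rw [sg_lap hq h1 h2 hne e1 e2 u]
  have c1 := sg_cell hq m lam u hu w1 h1 i1
  have c2 := sg_cell hq m lam u hu w2 h2 i2
  rw [← e1] at c1
  rw [← e2] at c2
  push_cast at E ⊢
  simp only [Set.mem_insert_iff, Set.mem_singleton_iff, not_or] at hlam
  obtain ⟨n1, n2, n3⟩ := hlam
  generalize ∑ j, (u (SGword q (w1 ++ [i1]) (q j)) : ℂ) = S1 at *
  generalize ∑ j, (u (SGword q (w2 ++ [i2]) (q j)) : ℂ) = S2 at *
  generalize ∑ j, (u (SGword q w1 (q j)) : ℂ) = T1 at *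
  generalize ∑ j, (u (SGword q w2 (q j)) : ℂ) = T2 at *
  generalize (u x : ℂ) = X at *
  have n3' : (3 - 2 * lam) ≠ 0 := fun h => n3 (by linear_combination (-1 / 2) * h)
  apply mul_left_cancel₀ n3'
  linear_combination (5 - 4 * lam) * (1 - 2 * lam) * E + (1 / 4) * (c1 + c2)
end
end

section
/- For every complex number s with Re(s) > 1, one has π^s · (1 − 2^{−s})^{−1} · Σ_{k=0}^{∞} ((2k+1)² π²)^{−s/2} = ζ(s), where ζ is the Riemann zeta function and, for a positive real λ, λ^{−s/2} denotes the principal complex power. Equivalently, ζ(s) = π^s (1 − 2^{−s})^{−1} ζ_S(s), where ζ_S(s) = Σ_{λ ∈ S} λ^{−s/2} is the geometric zeta function of the generating set S = {(2k+1)² π² : k = 0, 1, 2, …}. -/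
open Real

/-- The Lal–Lapidus theorem at `α = 1/2`: the Riemann zeta function equals, up to the trivial
factor `π^s`, the zeta function `ζ_ρ(s) = (1 - 2^{-s})⁻¹ ζ_S(s)` of the renormalization map,
where `ζ_S(s) = Σ_{k≥0} ((2k+1)² π²)^{-s/2}` is the geometric zeta function of the generating
set `S = {(2k+1)² π² : k ≥ 0}`. -/
theorem riemannZeta_eq_renormalization_zeta (s : ℂ) (hs : 1 < s.re) :
    (π : ℂ) ^ s * (1 - (2 : ℂ) ^ (-s))⁻¹ *
        ∑' k : ℕ, (((2 * (k : ℝ) + 1) ^ 2 * π ^ 2 : ℝ) : ℂ) ^ (-s / 2) =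
      riemannZeta s := by
  have hterm : ∀ k : ℕ, (((2 * (k : ℝ) + 1) ^ 2 * π ^ 2 : ℝ) : ℂ) ^ (-s / 2) =
      (π : ℂ) ^ (-s) * (1 / ((2 * k + 1 : ℕ) : ℂ) ^ s) := by
    intro k
    have hk : (0 : ℝ) < 2 * (k : ℝ) + 1 := by positivity
    have hx : (0 : ℝ) < (2 * (k : ℝ) + 1) * π := mul_pos hk pi_pos
    have h1 : (((2 * (k : ℝ) + 1) ^ 2 * π ^ 2 : ℝ) : ℂ) ^ (-s / 2) =
        (((2 * (k : ℝ) + 1) * π : ℝ) : ℂ) ^ (-s) := by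
      rw [← mul_pow, Complex.cpow_def_of_ne_zero (by exact_mod_cast (pow_pos hx 2).ne'),
        Complex.cpow_def_of_ne_zero (by exact_mod_cast hx.ne'),
        ← Complex.ofReal_log (pow_pos hx 2).le, ← Complex.ofReal_log hx.le, Real.log_pow]
      congr 1
      push_cast
      ring
    rw [h1, Complex.ofReal_mul, Complex.mul_cpow_ofReal_nonneg hk.le pi_pos.le, one_div,
      ← Complex.cpow_neg, mul_comm]
    push_cast
    rfl
  have hsum : Summable (fun n : ℕ => 1 / (n : ℂ) ^ s) :=
    Complex.summable_one_div_nat_cpow.mpr hs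
  have he : ∀ k : ℕ, 1 / ((2 * k : ℕ) : ℂ) ^ s = (2 : ℂ) ^ (-s) * (1 / (k : ℂ) ^ s) := by
    intro k
    have := Complex.natCast_mul_natCast_cpow 2 k s
    push_cast at this ⊢
    rw [this, Complex.cpow_neg, one_div, one_div, mul_inv]
  have hsplit := tsum_even_add_odd (f := fun n : ℕ => 1 / (n : ℂ) ^ s)
    (hsum.comp_injective (i := fun k : ℕ => 2 * k) (fun a b h => by simpa using h))
    (hsum.comp_injective (i := fun k : ℕ => 2 * k + 1) (fun a b h => by simpa using h))
  simp only [he] at hsplit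
  rw [tsum_mul_left, ← zeta_eq_tsum_one_div_nat_cpow hs] at hsplit
  have hne : (1 - (2 : ℂ) ^ (-s)) ≠ 0 := by
    intro h
    have h2 : ‖(2 : ℂ) ^ (-s)‖ = 1 := by rw [← sub_eq_zero.mp h, norm_one]
    have h3 : ‖(2 : ℂ) ^ (-s)‖ = (2 : ℝ) ^ (-s).re := by
      simpa using Complex.norm_cpow_eq_rpow_re_of_pos (x := 2) (by norm_num) (-s)
    have h4 : (2 : ℝ) ^ (-s).re < 1 :=
      Real.rpow_lt_one_of_one_lt_of_neg (by norm_num) (by rw [Complex.neg_re]; linarith)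
    linarith
  have hpi : (π : ℂ) ^ s * (π : ℂ) ^ (-s) = 1 := by
    have hp : (π : ℂ) ≠ 0 := by exact_mod_cast pi_ne_zero
    rw [← Complex.cpow_add _ _ hp, add_neg_cancel, Complex.cpow_zero]
  simp only [hterm]
  rw [tsum_mul_left]
  set T := ∑' k : ℕ, 1 / ((2 * k + 1 : ℕ) : ℂ) ^ s
  have hT : T = (1 - (2 : ℂ) ^ (-s)) * riemannZeta s := by linear_combination hsplit
  rw [hT]
  calc _ = ((π : ℂ) ^ s * (π : ℂ) ^ (-s)) *
        ((1 - (2 : ℂ) ^ (-s))⁻¹ * (1 - (2 : ℂ) ^ (-s))) * riemannZeta s := by ring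
    _ = _ := by rw [hpi, inv_mul_cancel₀ hne, one_mul, one_mul]
end

section
/- Let γ > 1 be a real number, let (λ_k)_{k≥1} be a sequence of positive real numbers, and let s ∈ ℂ with Re(s) > 0 be such that Σ_{k=1}^{∞} λ_k^{−Re(s)/2} < ∞. Then for every natural number n, the double series Σ_{p=−n}^{∞} Σ_{k=1}^{∞} (γ^p λ_k)^{−s/2} converges absolutely and equals (γ^{n s/2} / (1 − γ^{−s/2})) · Σ_{k=1}^{∞} λ_k^{−s/2}, where for a positive real t, t^{−s/2} denotes the principal complex power. -/
open Filter

/-- The Lal–Lapidus computation of the spectral zeta function of `H_{<n>}`: for `γ > 1`,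
positive `λ_k`, and `Re(s) > 0` with `Σ_k λ_k^{-Re(s)/2} < ∞`, the double series
`Σ_{p ≥ -n} Σ_k (γ^p λ_k)^{-s/2}` converges absolutely and equals
`(γ^{ns/2} / (1 - γ^{-s/2})) Σ_k λ_k^{-s/2}`. -/
theorem spectral_zeta_Hn_factorization
    (γ : ℝ) (hγ : 1 < γ) (lam : ℕ → ℝ) (hlam : ∀ k, 0 < lam k)
    (s : ℂ) (hs : 0 < s.re)
    (hsum : Summable fun k : ℕ => lam k ^ (-s.re / 2)) (n : ℕ) :
    Summable (fun q : {p : ℤ // -(n : ℤ) ≤ p} × ℕ =>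
        ‖((γ ^ (q.1 : ℤ) * lam q.2 : ℝ) : ℂ) ^ (-s / 2)‖) ∧
      ∑' q : {p : ℤ // -(n : ℤ) ≤ p} × ℕ,
          ((γ ^ (q.1 : ℤ) * lam q.2 : ℝ) : ℂ) ^ (-s / 2) =
        (γ : ℂ) ^ ((n : ℂ) * s / 2) / (1 - (γ : ℂ) ^ (-s / 2)) *
          ∑' k : ℕ, ((lam k : ℝ) : ℂ) ^ (-s / 2) := by
  have hγ0 : 0 < γ := by linarith
  have hγc : (γ : ℂ) ≠ 0 := by exact_mod_cast hγ0.ne'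
  let e : ℕ ≃ {p : ℤ // -(n : ℤ) ≤ p} :=
    { toFun := fun j => ⟨(j : ℤ) - n, by omega⟩
      invFun := fun p => (p.1 + n).toNat
      left_inv := fun j => by simp
      right_inv := fun p => by
        have := p.2
        apply Subtype.ext
        show (((p.1 + n).toNat : ℕ) : ℤ) - n = p.1
        omega }
  set r : ℂ := (γ : ℂ) ^ (-s / 2) with hr
  set c : ℂ := (γ : ℂ) ^ ((n : ℂ) * s / 2) with hc
  have key : ∀ (j k : ℕ), ((γ ^ ((e j : {p : ℤ // -(n : ℤ) ≤ p}) : ℤ) * lam k : ℝ) : ℂ) ^ (-s / 2)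
      = (c * r ^ j) * ((lam k : ℝ) : ℂ) ^ (-s / 2) := by
    intro j k
    have he : ((e j : {p : ℤ // -(n : ℤ) ≤ p}) : ℤ) = (j : ℤ) - n := rfl
    have hk := hlam k
    have hkc : (lam k : ℂ) ≠ 0 := by exact_mod_cast hk.ne'
    have hz : 0 < γ ^ ((j : ℤ) - n) := zpow_pos hγ0 _
    have hm : ((γ ^ ((j : ℤ) - n) * lam k : ℝ) : ℂ) ≠ 0 := by
      exact_mod_cast (mul_pos hz hk).ne'
    rw [he, hr, hc, Complex.cpow_def_of_ne_zero hm, Complex.cpow_def_of_ne_zero hkc,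
      Complex.cpow_def_of_ne_zero hγc, Complex.cpow_def_of_ne_zero hγc,
      ← Complex.ofReal_log (mul_pos hz hk).le, Real.log_mul hz.ne' hk.ne', Real.log_zpow,
      ← Complex.ofReal_log hk.le, ← Complex.ofReal_log hγ0.le, ← Complex.exp_nat_mul,
      ← Complex.exp_add, ← Complex.exp_add]
    congr 1
    push_cast
    ring
  have hrn : ‖r‖ < 1 := by
    rw [hr, Complex.norm_cpow_eq_rpow_re_of_pos hγ0]
    apply Real.rpow_lt_one_of_one_lt_of_neg hγ
    have : (-s / 2).re = -s.re / 2 := by simp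
    rw [this]
    linarith
  have hf : Summable fun k : ℕ => ‖((lam k : ℝ) : ℂ) ^ (-s / 2)‖ := by
    refine hsum.congr fun k => ?_
    rw [Complex.norm_cpow_eq_rpow_re_of_pos (hlam k)]
    simp
  have hg : Summable fun j : ℕ => ‖c * r ^ j‖ := by
    simp only [norm_mul, norm_pow]
    exact (summable_geometric_of_lt_one (norm_nonneg _) hrn).mul_left _
  let E : ℕ × ℕ ≃ {p : ℤ // -(n : ℤ) ≤ p} × ℕ := e.prodCongr (Equiv.refl ℕ)
  have hE : ∀ x : ℕ × ℕ, (((γ ^ ((E x).1 : ℤ) * lam (E x).2 : ℝ) : ℂ) ^ (-s / 2))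
      = (c * r ^ x.1) * ((lam x.2 : ℝ) : ℂ) ^ (-s / 2) := fun x => key x.1 x.2
  constructor
  · rw [← E.summable_iff]
    refine (hg.mul_norm hf).congr fun x => ?_
    simp only [Function.comp_apply]
    rw [hE]
  · rw [← E.tsum_eq]
    simp only [hE]
    rw [← tsum_mul_tsum_of_summable_norm hg hf, tsum_mul_left, tsum_geometric_of_norm_lt_one hrn,
      div_eq_mul_inv c]
end

section
/- Let R(z) = z(5 − 4z), and for z ∈ [0, 25/16] let R_−(z) = (5 − √(25 − 16z))/8 and R_+(z) = (5 + √(25 − 16z))/8 denote the two inverse branches of R. Fix z_0 ∈ (0, 25/16]. For each word w = (w_1, …, w_n) ∈ {−, +}^n, define z_w = R_{w_1}(R_{w_2}(⋯ R_{w_n}(z_0)⋯)); each z_w is a positive real number. Then for every s ∈ ℂ with Re(s) > 2 log 2 / log 5, the limit lim_{n→∞} Σ_{w ∈ {−,+}^n} (5^n z_w)^{−s/2} exists in ℂ, where for a positive real t, t^{−s/2} denotes the principal complex power. (This limit defines the polynomial zeta function ζ_{R,z_0}(s) of R.) -/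
open Filter

noncomputable section

/-- The two inverse branches of `R(z) = z(5 - 4z)`: `R₊` (for `true`) and `R₋` (for `false`). -/
def Rbranch : Bool → ℝ → ℝ
  | true, z => (5 + Real.sqrt (25 - 16 * z)) / 8
  | false, z => (5 - Real.sqrt (25 - 16 * z)) / 8

/-- The iterated preimage `z_w = R_{w₁}(R_{w₂}(⋯ R_{wₙ}(z₀)⋯))` for a word `w`. -/
def preimagePoint (z0 : ℝ) : List Bool → ℝ
  | [] => z0
  | b :: w => Rbranch b (preimagePoint z0 w)

lemma aux_minus {z : ℝ} (hz : z ∈ Set.Ioc (0 : ℝ) (25 / 16)) :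
    ∃ r, r = Rbranch false z ∧ 0 < r ∧ r ≤ 5 / 8 ∧ r * (5 - 4 * r) = z := by
  refine ⟨_, rfl, ?_⟩
  obtain ⟨h0, h1⟩ := hz
  have hs := Real.sq_sqrt (show (0 : ℝ) ≤ 25 - 16 * z by linarith)
  have hn := Real.sqrt_nonneg (25 - 16 * z)
  simp only [Rbranch]
  refine ⟨?_, by linarith, by nlinarith⟩
  nlinarith

lemma aux_plus {z : ℝ} (hz : z ∈ Set.Ioc (0 : ℝ) (25 / 16)) :
    5 / 8 ≤ Rbranch true z ∧ Rbranch true z ≤ 5 / 4 := by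
  obtain ⟨h0, h1⟩ := hz
  have hs := Real.sq_sqrt (show (0 : ℝ) ≤ 25 - 16 * z by linarith)
  have hn := Real.sqrt_nonneg (25 - 16 * z)
  simp only [Rbranch]
  refine ⟨by linarith, by nlinarith⟩

lemma aux_maps (b : Bool) {z : ℝ} (hz : z ∈ Set.Ioc (0 : ℝ) (25 / 16)) :
    Rbranch b z ∈ Set.Ioc (0 : ℝ) (25 / 16) := by
  cases b
  · obtain ⟨r, h, h0, h1, -⟩ := aux_minus hz
    rw [← h]; exact ⟨h0, by linarith⟩
  · obtain ⟨h0, h1⟩ := aux_plus hz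
    exact ⟨by linarith, by linarith⟩

lemma aux_pre {z0 : ℝ} (hz : z0 ∈ Set.Ioc (0 : ℝ) (25 / 16)) (l : List Bool) :
    preimagePoint z0 l ∈ Set.Ioc (0 : ℝ) (25 / 16) := by
  induction l with
  | nil => exact hz
  | cons b w ih => exact aux_maps b ih

lemma aux_iter {z : ℝ} (hz : z ∈ Set.Ioc (0 : ℝ) (25 / 16)) (k : ℕ) :
    (Rbranch false)^[k] z ∈ Set.Ioc (0 : ℝ) (25 / 16) := by
  induction k with
  | zero => exact hz
  | succ k ih => rw [Function.iterate_succ_apply']; exact aux_maps _ ih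

/-- The rescaled iterates of the lower branch. -/
def auxPhi (z : ℝ) (k : ℕ) : ℝ := 5 ^ k * (Rbranch false)^[k] z

lemma auxPhi_mono {z : ℝ} (hz : z ∈ Set.Ioc (0 : ℝ) (25 / 16)) : Monotone (auxPhi z) := by
  refine monotone_nat_of_le_succ fun k => ?_
  unfold auxPhi
  rw [Function.iterate_succ_apply', pow_succ, mul_assoc]
  obtain ⟨r, h, h0, h1, h2⟩ := aux_minus (aux_iter hz k)
  rw [← h, ← h2]
  refine mul_le_mul_of_nonneg_left ?_ (by positivity)
  nlinarith

lemma auxPhi_ge {z : ℝ} (hz : z ∈ Set.Ioc (0 : ℝ) (25 / 16)) (k : ℕ) : z ≤ auxPhi z k := by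
  have := auxPhi_mono hz (Nat.zero_le k)
  simpa [auxPhi] using this

lemma auxPhi_bdd {z : ℝ} (hz : z ∈ Set.Ioc (0 : ℝ) (25 / 16)) (k : ℕ) :
    auxPhi z k ≤ z / (1 - z / 2) := by
  have key : ∀ k : ℕ, (5 : ℝ) ^ k * ((Rbranch false)^[k] z / (1 - (Rbranch false)^[k] z / 2))
      ≤ z / (1 - z / 2) := by
    intro k
    induction k with
    | zero => simp
    | succ k ih =>
      refine le_trans ?_ ih
      rw [Function.iterate_succ_apply', pow_succ, mul_assoc]
      have hy := aux_iter hz k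
      obtain ⟨r, h, h0, h1, h2⟩ := aux_minus hy
      rw [← h]
      obtain ⟨hy0, hy1⟩ := hy
      rw [← h2] at hy0 hy1 ⊢
      gcongr
      rw [← mul_div_assoc, div_le_div_iff₀ (by linarith) (by linarith)]
      have : 0 ≤ r ^ 2 * (5 / 8 - r) := by
        apply mul_nonneg <;> nlinarith
      nlinarith [sq_nonneg r]
  refine le_trans ?_ (key k)
  unfold auxPhi
  obtain ⟨hy0, hy1⟩ := aux_iter hz k
  gcongr
  rw [le_div_iff₀ (by linarith)]
  nlinarith

lemma auxPhi_tendsto {z : ℝ} (hz : z ∈ Set.Ioc (0 : ℝ) (25 / 16)) :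
    ∃ L : ℝ, 0 < L ∧ Tendsto (auxPhi z) atTop (nhds L) := by
  have hb : BddAbove (Set.range (auxPhi z)) :=
    ⟨_, by rintro _ ⟨k, rfl⟩; exact auxPhi_bdd hz k⟩
  refine ⟨_, ?_, tendsto_atTop_ciSup (auxPhi_mono hz) hb⟩
  exact lt_of_lt_of_le hz.1 (le_trans (auxPhi_ge hz 0) (le_ciSup hb 0))

lemma aux_tendsto_cpow {z : ℝ} (hz : z ∈ Set.Ioc (0 : ℝ) (25 / 16)) (c : ℝ) (hc : 0 < c) (t : ℂ) :
    ∃ L : ℂ, Tendsto (fun k => ((c * auxPhi z k : ℝ) : ℂ) ^ t) atTop (nhds L) := by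
  obtain ⟨L, hL, h⟩ := auxPhi_tendsto hz
  refine ⟨((c * L : ℝ) : ℂ) ^ t, ?_⟩
  have h1 : Tendsto (fun k => ((c * auxPhi z k : ℝ) : ℂ)) atTop (nhds ((c * L : ℝ) : ℂ)) :=
    (Complex.continuous_ofReal.tendsto _).comp (h.const_mul c)
  exact h1.cpow tendsto_const_nhds (Complex.ofReal_mem_slitPlane.2 (by positivity))

/-- Sum of `g` over the preimages of order `n`. -/
def auxP (z0 : ℝ) (n : ℕ) (g : ℝ → ℂ) : ℂ :=
  ∑ w : Fin n → Bool, g (preimagePoint z0 (List.ofFn w))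

lemma auxP_succ (z0 : ℝ) (n : ℕ) (g : ℝ → ℂ) :
    auxP z0 (n + 1) g = auxP z0 n (fun x => g (Rbranch false x))
      + auxP z0 n (fun x => g (Rbranch true x)) := by
  unfold auxP
  rw [← (Fin.consEquiv (fun _ : Fin (n + 1) => Bool)).sum_comp, Fintype.sum_prod_type]
  simp [Fin.consEquiv, List.ofFn_succ, preimagePoint, add_comm]

lemma auxP_decomp (z0 : ℝ) (n : ℕ) (g : ℝ → ℂ) :
    auxP z0 n g = g ((Rbranch false)^[n] z0) + ∑ m ∈ Finset.range n,
      auxP z0 m (fun x => g ((Rbranch false)^[n - 1 - m] (Rbranch true x))) := by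
  induction n generalizing g with
  | zero => simp [auxP, preimagePoint]
  | succ n ih =>
    rw [auxP_succ, ih, Finset.sum_range_succ, Function.iterate_succ_apply', ← add_assoc]
    congr 1
    · congr 1
      refine Finset.sum_congr rfl fun m hm => ?_
      have hm := Finset.mem_range.1 hm
      have e : n + 1 - 1 - m = (n - 1 - m) + 1 := by omega
      simp only [e, Function.iterate_succ_apply']
    · simp

lemma aux_ratio {a : ℝ} (ha : 2 * Real.log 2 / Real.log 5 < 2 * a) :
    0 < a ∧ 2 * (5 : ℝ) ^ (-a) < 1 := by
  have h2 : 0 < Real.log 2 := Real.log_pos (by norm_num)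
  have h5 : 0 < Real.log 5 := Real.log_pos (by norm_num)
  rw [div_lt_iff₀ h5] at ha
  have ha' : Real.log 2 < a * Real.log 5 := by linarith
  refine ⟨by by_contra h; nlinarith, ?_⟩
  have : (2 : ℝ) < 5 ^ a := by
    rw [Real.lt_rpow_iff_log_lt (by norm_num) (by norm_num)]; exact ha'
  rw [Real.rpow_neg (by norm_num), ← div_eq_mul_inv, div_lt_one (by positivity)]
  exact this

/-- For `z₀ ∈ (0, 25/16]`, each iterated preimage `z_w` is positive, and for
`Re(s) > 2 log 2 / log 5` the limit defining the polynomial zeta function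
`ζ_{R,z₀}(s) = lim_n Σ_{w ∈ {−,+}ⁿ} (5ⁿ z_w)^{-s/2}` exists. -/
theorem polynomial_zeta_function_defined
    (z0 : ℝ) (hz0 : z0 ∈ Set.Ioc (0 : ℝ) (25 / 16)) :
    (∀ n : ℕ, ∀ w : Fin n → Bool, 0 < preimagePoint z0 (List.ofFn w)) ∧
      ∀ s : ℂ, 2 * Real.log 2 / Real.log 5 < s.re →
        ∃ L : ℂ,
          Tendsto
            (fun n : ℕ => ∑ w : Fin n → Bool,
              (((5 : ℝ) ^ n * preimagePoint z0 (List.ofFn w) : ℝ) : ℂ) ^ (-s / 2))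
            atTop (nhds L) := by
  refine ⟨fun n w => (aux_pre hz0 _).1, fun s hs => ?_⟩
  set t : ℂ := -s / 2 with ht
  obtain ⟨a, hta⟩ : ∃ a, a = s.re / 2 := ⟨_, rfl⟩
  have htre : t.re = -a := by
    rw [ht, hta]; simp; ring
  obtain ⟨ha, hq⟩ := aux_ratio (a := a) (by rw [hta]; linarith)
  set f : ℕ → ℕ → ℂ := fun n m => if m < n then auxP z0 m (fun x =>
    ((5 ^ n * (Rbranch false)^[n - 1 - m] (Rbranch true x) : ℝ) : ℂ) ^ t) else 0 with hf
  have hS : ∀ n : ℕ, ∑ w : Fin n → Bool,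
      (((5 : ℝ) ^ n * preimagePoint z0 (List.ofFn w) : ℝ) : ℂ) ^ t
      = ((1 * auxPhi z0 n : ℝ) : ℂ) ^ t + ∑' m, f n m := by
    intro n
    have := auxP_decomp z0 n (fun x => ((5 ^ n * x : ℝ) : ℂ) ^ t)
    rw [tsum_eq_sum (s := Finset.range n), one_mul]
    · unfold auxP at this
      rw [this]
      refine congrArg₂ _ rfl (Finset.sum_congr rfl fun m hm => ?_)
      rw [hf]; simp only [if_pos (Finset.mem_range.1 hm)]; rfl
    · intro m hm
      rw [hf]; simp only [if_neg (fun h => hm (Finset.mem_range.2 h))]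
  have hrw : ∀ (m k : ℕ) (u : ℝ), (5 : ℝ) ^ (k + (m + 1)) * (Rbranch false)^[k + (m + 1) - 1 - m] u
      = 5 ^ (m + 1) * auxPhi u k := by
    intro m k u
    have : k + (m + 1) - 1 - m = k := by omega
    rw [this, auxPhi, pow_add]; ring
  have hlim : ∀ m, ∃ L, Tendsto (fun n => f n m) atTop (nhds L) := by
    intro m
    choose L hL using fun w : Fin m → Bool =>
      aux_tendsto_cpow (aux_maps true (aux_pre hz0 (List.ofFn w))) (5 ^ (m + 1)) (by positivity) t
    refine ⟨∑ w, L w, ?_⟩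
    rw [← tendsto_add_atTop_iff_nat (m + 1)]
    refine (tendsto_finsetSum _ fun w _ => hL w).congr fun k => ?_
    rw [hf]
    simp only [if_pos (show m < k + (m + 1) by omega), auxP, hrw]
  choose G hG using hlim
  have hbound : ∀ n m, ‖f n m‖ ≤ (5 * (5 / 8) : ℝ) ^ (-a) * (2 * (5 : ℝ) ^ (-a)) ^ m := by
    intro n m
    rw [hf]
    by_cases h : m < n
    · simp only [if_pos h]
      obtain ⟨k, rfl⟩ : ∃ k, n = k + (m + 1) := ⟨n - (m + 1), by omega⟩
      simp only [auxP, hrw]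
      refine (norm_sum_le_of_le (f := fun w : Fin m → Bool => _) _
        (n := fun _ => (5 * (5 / 8) : ℝ) ^ (-a) * ((5 : ℝ) ^ (-a)) ^ m) fun w _ => ?_).trans ?_
      · have hy := aux_pre hz0 (List.ofFn w)
        have hu := aux_maps true hy
        have h58 := (aux_plus hy).1.trans (auxPhi_ge hu k)
        rw [Complex.norm_cpow_eq_rpow_re_of_pos
          (mul_pos (by positivity) (by linarith)), htre]
        have e : ((5 : ℝ) ^ (-a)) ^ m = ((5 : ℝ) ^ m) ^ (-a) := by
          rw [← Real.rpow_natCast, ← Real.rpow_natCast, ← Real.rpow_mul (by norm_num),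
            ← Real.rpow_mul (by norm_num), mul_comm]
        rw [e, ← Real.mul_rpow (by norm_num) (by positivity)]
        refine Real.rpow_le_rpow_of_nonpos (by positivity) ?_ (by linarith)
        rw [pow_succ]
        have : (0 : ℝ) < 5 ^ m := by positivity
        nlinarith
      · simp only [Finset.sum_const, Finset.card_univ, Fintype.card_fun, Fintype.card_bool,
          Fintype.card_fin, nsmul_eq_mul, mul_pow]
        push_cast
        apply le_of_eq; ring
    · simp only [if_neg h, norm_zero]; positivity
  have hsum : Summable fun m : ℕ => (5 * (5 / 8) : ℝ) ^ (-a) * (2 * (5 : ℝ) ^ (-a)) ^ m :=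
    (summable_geometric_of_lt_one (by positivity) hq).mul_left _
  obtain ⟨L0, hL0⟩ := aux_tendsto_cpow hz0 1 one_pos t
  refine ⟨L0 + ∑' m, G m, ?_⟩
  simp only [hS]
  exact hL0.add (tendsto_tsum_of_dominated_convergence hsum hG
    (Eventually.of_forall fun n m => hbound n m))
end
end

section
/- Let R(z) = z(5 − 4z), fix z_0 ∈ {3/4, 5/4}, and let ζ_{R,z_0}(s) = lim_{n→∞} Σ_{w ∈ {−,+}^n} (5^n z_w)^{−s/2} be the polynomial zeta function of R, where for each word w = (w_1, …, w_n) ∈ {−, +}^n one sets z_w = R_{w_1}(R_{w_2}(⋯ R_{w_n}(z_0)⋯)) using the inverse branches R_∓(z) = (5 ∓ √(25 − 16z))/8; this limit exists for Re(s) > 2 log 2 / log 5. Then there exists ε > 0 and a meromorphic function on the half-plane {s ∈ ℂ : Re(s) > −ε} that agrees with ζ_{R,z_0}(s) on the half-plane {s ∈ ℂ : Re(s) > 2 log 2 / log 5}. -/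
open Filter

noncomputable section

namespace PZ

/-- The invariant interval. -/
def I : Set ℝ := Set.Ioc 0 (5/4)

lemma q_facts {x : ℝ} (hx : x ∈ I) :
    (20:ℝ)/9 ≤ Real.sqrt (25 - 16 * x) ∧ Real.sqrt (25 - 16 * x) < 5 ∧
      Real.sqrt (25 - 16 * x) ^ 2 = 25 - 16 * x := by
  obtain ⟨h0, h1⟩ := hx
  refine ⟨?_, ?_, Real.sq_sqrt (by linarith)⟩
  · apply Real.le_sqrt_of_sq_le; norm_num; linarith
  · rw [Real.sqrt_lt' (by norm_num)]; linarith

lemma q_lip {x y : ℝ} (hx : x ∈ I) (hy : y ∈ I) :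
    |Real.sqrt (25 - 16 * x) - Real.sqrt (25 - 16 * y)| ≤ 18/5 * |x - y| := by
  obtain ⟨a1, a2, a3⟩ := q_facts hx
  obtain ⟨b1, b2, b3⟩ := q_facts hy
  set p := Real.sqrt (25 - 16 * x)
  set q := Real.sqrt (25 - 16 * y)
  have h : (p - q) * (p + q) = -16 * (x - y) := by nlinarith
  have h2 : |p - q| * (p + q) = 16 * |x - y| := by
    have e : |(p - q) * (p + q)| = |p - q| * (p + q) := by
      rw [abs_mul, abs_of_pos (show 0 < p + q by linarith)]
    rw [← e, h, abs_mul]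
    norm_num
  have h3 := abs_nonneg (p - q)
  nlinarith

lemma minus_le {x : ℝ} (hx : x ∈ I) : Rbranch false x ≤ 9/20 * x := by
  obtain ⟨a1, a2, a3⟩ := q_facts hx
  simp only [Rbranch]
  nlinarith [hx.1]

lemma minus_mem {x : ℝ} (hx : x ∈ I) : Rbranch false x ∈ I := by
  have h := minus_le hx
  obtain ⟨a1, a2, a3⟩ := q_facts hx
  refine ⟨?_, ?_⟩
  · simp only [Rbranch]; linarith
  · linarith [hx.1, hx.2]

lemma plus_ge {x : ℝ} : 5/8 ≤ Rbranch true x := by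
  simp only [Rbranch]
  linarith [Real.sqrt_nonneg (25 - 16 * x)]

lemma plus_mem {x : ℝ} (hx : x ∈ I) : Rbranch true x ∈ I := by
  obtain ⟨a1, a2, a3⟩ := q_facts hx
  refine ⟨by linarith [@plus_ge x], ?_⟩
  simp only [Rbranch]; linarith

lemma branch_mem (b : Bool) {x : ℝ} (hx : x ∈ I) : Rbranch b x ∈ I := by
  cases b
  · exact minus_mem hx
  · exact plus_mem hx

lemma branch_lip (b : Bool) {x y : ℝ} (hx : x ∈ I) (hy : y ∈ I) :
    |Rbranch b x - Rbranch b y| ≤ 9/20 * |x - y| := by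
  have h := q_lip hx hy
  cases b
  · simp only [Rbranch]
    rw [show (5 - Real.sqrt (25 - 16 * x)) / 8 - (5 - Real.sqrt (25 - 16 * y)) / 8
      = -((Real.sqrt (25 - 16 * x) - Real.sqrt (25 - 16 * y)) / 8) by ring, abs_neg, abs_div]
    norm_num; linarith
  · simp only [Rbranch]
    rw [show (5 + Real.sqrt (25 - 16 * x)) / 8 - (5 + Real.sqrt (25 - 16 * y)) / 8
      = ((Real.sqrt (25 - 16 * x) - Real.sqrt (25 - 16 * y)) / 8) by ring, abs_div]
    norm_num; linarith

lemma log_lip {c a b : ℝ} (hc : 0 < c) (ha : c ≤ a) (hb : c ≤ b) :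
    |Real.log a - Real.log b| ≤ |a - b| / c := by
  have key : ∀ a b : ℝ, c ≤ a → c ≤ b → Real.log a - Real.log b ≤ |a - b| / c := by
    intro a b ha hb
    have ha' : 0 < a := by linarith
    have hb' : 0 < b := by linarith
    rw [← Real.log_div ha'.ne' hb'.ne']
    calc Real.log (a / b) ≤ a / b - 1 := Real.log_le_sub_one_of_pos (by positivity)
      _ = (a - b) / b := by field_simp
      _ ≤ |a - b| / b := by gcongr; exact le_abs_self _
      _ ≤ |a - b| / c := by gcongr
  rw [abs_le]
  constructor
  · have := key b a hb ha
    rw [abs_sub_comm] at this; linarith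
  · exact key a b ha hb

/-- `phi k z = log (5^k R_-^k z)`. -/
def phi : ℕ → ℝ → ℝ
  | 0, z => Real.log z
  | k + 1, z => Real.log 5 + phi k (Rbranch false z)

lemma d0 {x : ℝ} (hx : x ∈ I) :
    phi 1 x - phi 0 x = Real.log 10 - Real.log (5 + Real.sqrt (25 - 16 * x)) := by
  obtain ⟨a1, a2, a3⟩ := q_facts hx
  have hm := (minus_mem hx).1
  have hx0 := hx.1
  simp only [phi]
  have e : 5 * Rbranch false x * (5 + Real.sqrt (25 - 16 * x)) = 10 * x := by
    simp only [Rbranch]; nlinarith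
  have h := congrArg Real.log e
  rw [Real.log_mul (by positivity) (by positivity), Real.log_mul (by positivity) (by positivity),
    Real.log_mul (by positivity) (by positivity)] at h
  linarith

lemma d_lip (k : ℕ) : ∀ {x y : ℝ}, x ∈ I → y ∈ I →
    |(phi (k+1) x - phi k x) - (phi (k+1) y - phi k y)| ≤ 4 * (9/20)^k * |x - y| := by
  induction k with
  | zero =>
    intro x y hx hy
    rw [zero_add, d0 hx, d0 hy]
    obtain ⟨a1, a2, a3⟩ := q_facts hx
    obtain ⟨b1, b2, b3⟩ := q_facts hy
    have h := log_lip (c := 1) (a := 5 + Real.sqrt (25 - 16 * y)) (b := 5 + Real.sqrt (25 - 16 * x))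
      one_pos (by linarith) (by linarith)
    have h2 := q_lip hy hx
    rw [show ∀ a b c : ℝ, a - b - (a - c) = c - b by intros; ring]
    refine h.trans ?_
    rw [show ∀ b c : ℝ, 5 + b - (5 + c) = b - c by intros; ring, div_one]
    refine h2.trans ?_
    rw [abs_sub_comm]
    nlinarith [abs_nonneg (x - y)]
  | succ k ih =>
    intro x y hx hy
    have h := ih (minus_mem hx) (minus_mem hy)
    have h2 := branch_lip false hx hy
    have e : (phi (k+1+1) x - phi (k+1) x) - (phi (k+1+1) y - phi (k+1) y)
      = (phi (k+1) (Rbranch false x) - phi k (Rbranch false x))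
        - (phi (k+1) (Rbranch false y) - phi k (Rbranch false y)) := by
      rw [phi, phi, phi, phi]
      simp only [phi]; ring
    rw [e]
    refine h.trans ?_
    rw [pow_succ]
    have hp : (0:ℝ) < (9/20)^k := by positivity
    nlinarith

lemma d_bound (k : ℕ) : ∀ {x : ℝ}, x ∈ I →
    |phi (k+1) x - phi k x| ≤ 4 * (9/20)^k * x := by
  induction k with
  | zero =>
    intro x hx
    rw [zero_add, d0 hx]
    obtain ⟨a1, a2, a3⟩ := q_facts hx
    have h := log_lip (c := 1) (a := 10) (b := 5 + Real.sqrt (25 - 16 * x))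
      one_pos (by linarith) (by linarith)
    have h2 := minus_le hx
    simp only [Rbranch] at h2
    refine h.trans ?_
    rw [abs_of_pos (by linarith)]
    linarith [hx.1]
  | succ k ih =>
    intro x hx
    have h := ih (minus_mem hx)
    have h2 := minus_le hx
    have e : phi (k+1+1) x - phi (k+1) x
      = (phi (k+1) (Rbranch false x) - phi k (Rbranch false x)) := by
      rw [phi, phi]
      simp only [phi]; ring
    rw [e]
    refine h.trans ?_
    rw [pow_succ]
    have hp : (0:ℝ) < (9/20)^k := by positivity
    nlinarith

/-- The limit of `phi k`. -/
def Phi (z : ℝ) : ℝ := limUnder atTop (fun k => phi k z)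

lemma phi_tendsto {x : ℝ} (hx : x ∈ I) : Tendsto (fun k => phi k x) atTop (nhds (Phi x)) := by
  apply CauchySeq.tendsto_limUnder
  apply cauchySeq_of_le_geometric (9/20) (4 * x) (by norm_num)
  intro n
  rw [dist_comm, Real.dist_eq]
  have := d_bound n hx
  linarith

/-- `f k = phi k ∘ R_+`. -/
def f (k : ℕ) (z : ℝ) : ℝ := phi k (Rbranch true z)

/-- limit of `f k`. -/
def finf (z : ℝ) : ℝ := Phi (Rbranch true z)

lemma f_tendsto {x : ℝ} (hx : x ∈ I) : Tendsto (fun k => f k x) atTop (nhds (finf x)) :=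
  phi_tendsto (plus_mem hx)

lemma f_bound (k : ℕ) {x : ℝ} (hx : x ∈ I) : |f k x| ≤ 11 := by
  have : |f k x| ≤ 11 - 10 * (9/20)^k := by
    induction k with
    | zero =>
      simp only [f, phi]
      have h1 := (plus_mem hx).2
      have h2 := @plus_ge x
      have := log_lip (c := 5/8) (a := Rbranch true x) (b := 1) (by norm_num) h2 (by norm_num)
      rw [Real.log_one, sub_zero] at this
      refine this.trans ?_
      rw [div_le_iff₀ (by norm_num), abs_le]
      constructor <;> norm_num <;> linarith
    | succ k ih =>
      have h := d_bound k (plus_mem hx)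
      have h1 := (plus_mem hx).2
      have hp : (0:ℝ) < (9/20)^k := by positivity
      have : |f (k+1) x| ≤ |f k x| + |f (k+1) x - f k x| := by
        have := abs_add_le (f k x) (f (k+1) x - f k x)
        simpa using this
      simp only [f] at *
      rw [pow_succ]
      nlinarith
  have hp : (0:ℝ) < (9/20)^k := by positivity
  linarith

lemma f_lip (k : ℕ) {x y : ℝ} (hx : x ∈ I) (hy : y ∈ I) : |f k x - f k y| ≤ 10 * |x - y| := by
  have : |f k x - f k y| ≤ (10 - 8 * (9/20)^k) * |Rbranch true x - Rbranch true y| := by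
    induction k with
    | zero =>
      simp only [f, phi]
      have := log_lip (c := 5/8) (by norm_num) (@plus_ge x) (@plus_ge y)
      refine this.trans ?_
      have := abs_nonneg (Rbranch true x - Rbranch true y)
      rw [div_le_iff₀ (by norm_num)]
      norm_num; linarith
    | succ k ih =>
      have h := d_lip k (plus_mem hx) (plus_mem hy)
      have hp : (0:ℝ) < (9/20)^k := by positivity
      have : |f (k+1) x - f (k+1) y| ≤ |f k x - f k y| +
          |(f (k+1) x - f k x) - (f (k+1) y - f k y)| := by
        have := abs_add_le (f k x - f k y) ((f (k+1) x - f k x) - (f (k+1) y - f k y))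
        refine le_trans (le_of_eq ?_) this
        congr 1; ring
      simp only [f] at *
      rw [pow_succ]
      have := abs_nonneg (Rbranch true x - Rbranch true y)
      nlinarith
  have hp : (0:ℝ) < (9/20)^k := by positivity
  have h2 := branch_lip true hx hy
  have := abs_nonneg (Rbranch true x - Rbranch true y)
  nlinarith [abs_nonneg (x - y)]

lemma finf_bound {x : ℝ} (hx : x ∈ I) : |finf x| ≤ 11 :=
  le_of_tendsto (f_tendsto hx).abs (Eventually.of_forall fun k => f_bound k hx)

lemma finf_lip {x y : ℝ} (hx : x ∈ I) (hy : y ∈ I) : |finf x - finf y| ≤ 10 * |x - y| :=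
  le_of_tendsto ((f_tendsto hx).sub (f_tendsto hy)).abs
    (Eventually.of_forall fun k => f_lip k hx hy)

/-- Transfer operator. -/
def L (g : ℝ → ℂ) : ℝ → ℂ := fun z => g (Rbranch false z) + g (Rbranch true z)

lemma L_succ (m : ℕ) (g : ℝ → ℂ) (z : ℝ) :
    L^[m+1] g z = L^[m] g (Rbranch false z) + L^[m] g (Rbranch true z) := by
  rw [Function.iterate_succ_apply']; rfl

lemma L_bound {g : ℝ → ℂ} {C : ℝ} (hg : ∀ z ∈ I, ‖g z‖ ≤ C) (m : ℕ) :
    ∀ z ∈ I, ‖L^[m] g z‖ ≤ 2^m * C := by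
  induction m with
  | zero => simpa using hg
  | succ m ih =>
    intro z hz
    rw [L_succ, pow_succ]
    have := norm_add_le (L^[m] g (Rbranch false z)) (L^[m] g (Rbranch true z))
    linarith [ih _ (minus_mem hz), ih _ (plus_mem hz)]

lemma L_lip {g : ℝ → ℂ} {K : ℝ} (hK : 0 ≤ K) (hg : ∀ x ∈ I, ∀ y ∈ I, ‖g x - g y‖ ≤ K * |x - y|)
    (m : ℕ) : ∀ x ∈ I, ∀ y ∈ I, ‖L^[m] g x - L^[m] g y‖ ≤ (9/10)^m * K * |x - y| := by
  induction m with
  | zero => simpa using hg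
  | succ m ih =>
    intro x hx y hy
    rw [L_succ, L_succ, pow_succ, add_sub_add_comm]
    refine (norm_add_le _ _).trans ?_
    have h1 := ih _ (minus_mem hx) _ (minus_mem hy)
    have h2 := ih _ (plus_mem hx) _ (plus_mem hy)
    have h3 := branch_lip false hx hy
    have h4 := branch_lip true hx hy
    have : 0 ≤ (9/10)^m * K := by positivity
    nlinarith

lemma L_congr {g h : ℝ → ℂ} (hg : ∀ z ∈ I, g z = h z) (m : ℕ) :
    ∀ z ∈ I, L^[m] g z = L^[m] h z := by
  induction m with
  | zero => simpa using hg
  | succ m ih =>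
    intro z hz
    rw [L_succ, L_succ, ih _ (minus_mem hz), ih _ (plus_mem hz)]

lemma L_tendsto {g : ℕ → ℝ → ℂ} {h : ℝ → ℂ}
    (hg : ∀ z ∈ I, Tendsto (fun k => g k z) atTop (nhds (h z))) (m : ℕ) :
    ∀ z ∈ I, Tendsto (fun k => L^[m] (g k) z) atTop (nhds (L^[m] h z)) := by
  induction m with
  | zero => exact hg
  | succ m ih =>
    intro z hz
    simp only [L_succ]
    exact (ih _ (minus_mem hz)).add (ih _ (plus_mem hz))

lemma L_smul (c : ℂ) (g : ℝ → ℂ) (m : ℕ) :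
    ∀ z, L^[m] (fun z => c * g z) z = c * L^[m] g z := by
  induction m with
  | zero => simp
  | succ m ih => intro z; rw [L_succ, L_succ, ih, ih]; ring

lemma L_add (g h : ℝ → ℂ) (m : ℕ) :
    ∀ z, L^[m] (fun z => g z + h z) z = L^[m] g z + L^[m] h z := by
  induction m with
  | zero => simp
  | succ m ih => intro z; rw [L_succ, L_succ, L_succ, ih, ih]; ring

lemma pp_mem {z0 : ℝ} (h : z0 ∈ I) (w : List Bool) : preimagePoint z0 w ∈ I := by
  induction w with
  | nil => exact h
  | cons b w ih => exact branch_mem b ih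

lemma sum_eq (z0 : ℝ) (n : ℕ) : ∀ g : ℝ → ℂ,
    ∑ w : Fin n → Bool, g (preimagePoint z0 (List.ofFn w)) = L^[n] g z0 := by
  induction n with
  | zero => intro g; simp [preimagePoint]
  | succ n ih =>
    intro g
    rw [Function.iterate_succ_apply, ← ih, ← (Fin.consEquiv (fun _ => Bool)).sum_comp,
      Fintype.sum_prod_type]
    simp only [Fintype.sum_bool]
    rw [← Finset.sum_add_distrib]
    apply Finset.sum_congr rfl
    intro w _
    have key : ∀ c : Bool, preimagePoint z0 (List.ofFn ((Fin.consEquiv fun _ => Bool) (c, w)))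
        = Rbranch c (preimagePoint z0 (List.ofFn w)) := by
      intro c
      have e : List.ofFn ((Fin.consEquiv fun _ => Bool) (c, w)) = c :: List.ofFn w :=
        List.ofFn_cons c w
      rw [e, preimagePoint]
    rw [L, add_comm, key, key]

/-- `E s k z = (5^k R_-^k z)^(-s/2)`. -/
def E (s : ℂ) (k : ℕ) (z : ℝ) : ℂ := Complex.exp (-s/2 * (phi k z : ℂ))

/-- `X s = 5^(-s/2)`. -/
def X (s : ℂ) : ℂ := Complex.exp (-s/2 * (Real.log 5 : ℝ))

lemma E_step (s : ℂ) (k : ℕ) (z : ℝ) :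
    L (fun z => X s * E s k z) z = E s (k+1) z + X s * E s k (Rbranch true z) := by
  simp only [L, E, X, phi]
  rw [← Complex.exp_add]
  congr 2
  push_cast; ring

lemma expand (s : ℂ) (z0 : ℝ) (n : ℕ) : ∀ k : ℕ,
    X s ^ n * L^[n] (E s k) z0 = E s (k+n) z0 +
      ∑ m ∈ Finset.range n, X s ^ (m+1) *
        L^[m] (fun z => Complex.exp (-s/2 * (f (k + (n-1-m)) z : ℂ))) z0 := by
  induction n with
  | zero => simp
  | succ n ih =>
    intro k
    have h1 : X s ^ (n+1) * L^[n+1] (E s k) z0 = X s ^ n * L^[n+1] (fun z => X s * E s k z) z0 := by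
      rw [L_smul]; ring
    rw [h1, Function.iterate_succ_apply,
      show L (fun z => X s * E s k z) = fun z => E s (k+1) z + X s * E s k (Rbranch true z) from
        funext (E_step s k), L_add, mul_add, ih, L_smul (X s) (fun z => E s k (Rbranch true z)),
      Finset.sum_range_succ, add_assoc]
    congr 1
    · congr 1; omega
    congr 1
    · apply Finset.sum_congr rfl
      intro m hm
      rw [Finset.mem_range] at hm
      rw [show k + 1 + (n - 1 - m) = k + (n + 1 - 1 - m) by omega]
    · simp only [E, f]
      rw [show k + (n + 1 - 1 - n) = k by omega]
      ring

lemma S_eq (s : ℂ) {z0 : ℝ} (hz : z0 ∈ I) (n : ℕ) :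
    ∑ w : Fin n → Bool, (((5 : ℝ) ^ n * preimagePoint z0 (List.ofFn w) : ℝ) : ℂ) ^ (-s / 2)
      = X s ^ n * L^[n] (E s 0) z0 := by
  rw [← sum_eq, Finset.mul_sum]
  apply Finset.sum_congr rfl
  intro w _
  have hp := (pp_mem hz (List.ofFn w)).1
  have h5 : (0:ℝ) < 5 ^ n := by positivity
  rw [Complex.cpow_def_of_ne_zero (by exact_mod_cast (mul_pos h5 hp).ne'),
    ← Complex.ofReal_log (mul_pos h5 hp).le, Real.log_mul h5.ne' hp.ne', Real.log_pow]
  simp only [E, X, phi]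
  rw [← Complex.exp_nat_mul, ← Complex.exp_add]
  congr 1
  push_cast; ring

/-- Limit weight. -/
def G (s : ℂ) (z : ℝ) : ℂ := Complex.exp (-s/2 * (finf z : ℂ))

lemma norm_exp_le (s : ℂ) {t : ℝ} (ht : |t| ≤ 11) :
    ‖Complex.exp (-s/2 * (t : ℂ))‖ ≤ Real.exp (11 * ‖s‖) := by
  rw [Complex.norm_exp]
  apply Real.exp_le_exp.2
  refine (Complex.re_le_norm _).trans ?_
  rw [norm_mul, norm_div, norm_neg, Complex.norm_real, Real.norm_eq_abs, Complex.norm_ofNat]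
  nlinarith [norm_nonneg s, abs_nonneg t]

lemma X_norm (s : ℂ) : ‖X s‖ = Real.exp (-s.re/2 * Real.log 5) := by
  rw [X, Complex.norm_exp, Complex.re_mul_ofReal]
  congr 2
  simp

lemma exp_lip (s : ℂ) {t u : ℝ} (ht : |t| ≤ 11) (hu : |u| ≤ 11) :
    ‖Complex.exp (-s/2 * (t : ℂ)) - Complex.exp (-s/2 * (u : ℂ))‖
      ≤ ‖s‖ * Real.exp (11 * ‖s‖) * |t - u| := by
  have := Convex.norm_image_sub_le_of_norm_hasDerivWithin_le (𝕜 := ℝ)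
    (f := fun t : ℝ => Complex.exp (-s/2 * (t : ℂ)))
    (f' := fun t : ℝ => Complex.exp (-s/2 * (t : ℂ)) * (-s/2))
    (C := ‖s‖ * Real.exp (11 * ‖s‖)) (s := Set.Icc (-11) 11) (x := u) (y := t)
    ?_ ?_ (convex_Icc _ _) (abs_le.1 hu) (abs_le.1 ht)
  · simpa using this
  · intro x _
    have h : HasDerivAt (fun t : ℝ => -s/2 * (t : ℂ)) (-s/2) x := by
      simpa using (Complex.ofRealCLM.hasDerivAt (x := x)).const_mul (-s/2)
    exact h.cexp.hasDerivWithinAt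
  · intro x hx
    rw [norm_mul, norm_div, norm_neg, Complex.norm_ofNat]
    have := norm_exp_le s (abs_le.2 hx)
    have h2 := norm_nonneg s
    have h3 := norm_nonneg (Complex.exp (-s/2 * (x : ℂ)))
    nlinarith

lemma G_bound (s : ℂ) : ∀ z ∈ I, ‖G s z‖ ≤ Real.exp (11 * ‖s‖) :=
  fun _ hz => norm_exp_le s (finf_bound hz)

lemma G_lip (s : ℂ) : ∀ x ∈ I, ∀ y ∈ I,
    ‖G s x - G s y‖ ≤ (‖s‖ * Real.exp (11 * ‖s‖) * 10) * |x - y| := by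
  intro x hx y hy
  refine (exp_lip s (finf_bound hx) (finf_bound hy)).trans ?_
  rw [mul_assoc _ 10]
  gcongr
  exact finf_lip hx hy

/-- coefficients -/
def a (z0 : ℝ) (s : ℂ) (m : ℕ) : ℂ := L^[m] (G s) z0

/-- corrections -/
def b (z0 : ℝ) (s : ℂ) (m : ℕ) : ℂ := a z0 s (m+1) - 2 * a z0 s m

lemma b_bound {z0 : ℝ} (hz : z0 ∈ I) (s : ℂ) (m : ℕ) :
    ‖b z0 s m‖ ≤ 40 * (‖s‖ * Real.exp (11 * ‖s‖)) * (9/10)^m := by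
  have e : b z0 s m = (L^[m] (G s) (Rbranch false z0) - L^[m] (G s) z0)
      + (L^[m] (G s) (Rbranch true z0) - L^[m] (G s) z0) := by
    rw [b, a, a, L_succ]; ring
  rw [e]
  refine (norm_add_le _ _).trans ?_
  have h : ∀ y ∈ I, ‖L^[m] (G s) y - L^[m] (G s) z0‖ ≤
      20 * (‖s‖ * Real.exp (11 * ‖s‖)) * (9/10)^m := by
    intro y hy
    refine (L_lip (by positivity) (G_lip s) m y hy z0 hz).trans ?_
    have : |y - z0| ≤ 2 := by
      rw [abs_le]; constructor <;> linarith [hy.1, hy.2, hz.1, hz.2]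
    have h0 : 0 ≤ (9/10)^m * (‖s‖ * Real.exp (11 * ‖s‖) * 10) := by positivity
    nlinarith
  linarith [h _ (minus_mem hz), h _ (plus_mem hz)]

lemma a_diff (m : ℕ) : ∀ z, Differentiable ℂ (fun s => a z s m) := by
  induction m with
  | zero => intro z; simp only [a, Function.iterate_zero, id, G]; fun_prop
  | succ m ih =>
    intro z
    simp only [a, L_succ] at ih ⊢
    exact (ih _).add (ih _)

lemma X_diff : Differentiable ℂ X := by
  unfold X; fun_prop

/-- the correction series -/
def B (z0 : ℝ) (s : ℂ) : ℂ := ∑' m, b z0 s m * X s ^ m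

lemma X_le {s : ℂ} (hs : -(1/10) < s.re) : ‖X s‖ ≤ 11/10 := by
  rw [X_norm]
  have h5 : (0:ℝ) < Real.log 5 := Real.log_pos (by norm_num)
  have h : Real.log 5 ≤ 20 * Real.log (11/10) := by
    have : Real.log 5 ≤ Real.log ((11/10)^20) := Real.log_le_log (by norm_num) (by norm_num)
    rw [Real.log_pow] at this
    exact_mod_cast this
  calc Real.exp (-s.re/2 * Real.log 5) ≤ Real.exp (Real.log (11/10)) := by
        apply Real.exp_le_exp.2; nlinarith
    _ = 11/10 := Real.exp_log (by norm_num)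

lemma bX_bound {z0 : ℝ} (hz : z0 ∈ I) {s : ℂ} (hs : -(1/10) < s.re) {N : ℝ} (hN : ‖s‖ ≤ N) (m : ℕ) :
    ‖b z0 s m * X s ^ m‖ ≤ 40 * (N * Real.exp (11 * N)) * (99/100)^m := by
  have h0 : 0 ≤ N := (norm_nonneg s).trans hN
  rw [norm_mul, norm_pow, show (99/100:ℝ) = 9/10 * (11/10) by norm_num, mul_pow, ← mul_assoc]
  gcongr
  · refine (b_bound hz s m).trans ?_
    gcongr
  · exact X_le hs

lemma bound_summable (C : ℝ) : Summable (fun m : ℕ => C * (99/100:ℝ)^m) :=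
  (summable_geometric_of_lt_one (by norm_num) (by norm_num)).mul_left C

lemma bX_summable {z0 : ℝ} (hz : z0 ∈ I) {s : ℂ} (hs : -(1/10) < s.re) :
    Summable (fun m => b z0 s m * X s ^ m) :=
  Summable.of_norm_bounded (bound_summable _) (bX_bound hz hs le_rfl)

lemma B_analytic {z0 : ℝ} (hz : z0 ∈ I) {s : ℂ} (hs : -(1/10) < s.re) : AnalyticAt ℂ (B z0) s := by
  have ho : IsOpen ({t : ℂ | -(1/10) < t.re} ∩ {t : ℂ | ‖t‖ < ‖s‖ + 1}) :=
    (isOpen_lt continuous_const Complex.continuous_re).inter (isOpen_lt continuous_norm continuous_const)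
  have hd : DifferentiableOn ℂ (B z0) ({t : ℂ | -(1/10) < t.re} ∩ {t : ℂ | ‖t‖ < ‖s‖ + 1}) := by
    apply Complex.differentiableOn_tsum_of_summable_norm
      (bound_summable (40 * ((‖s‖ + 1) * Real.exp (11 * (‖s‖ + 1))))) _ ho
    · rintro m t ⟨h1, h2⟩
      exact bX_bound hz h1 (le_of_lt h2) m
    · intro m
      apply Differentiable.differentiableOn
      exact ((a_diff (m+1) z0).sub ((a_diff m z0).const_mul 2)).mul (X_diff.pow m)
  exact hd.analyticAt (ho.mem_nhds ⟨hs, by simp⟩)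

/-- The continuation. -/
def F (z0 : ℝ) (s : ℂ) : ℂ :=
  Complex.exp (-s/2 * (Phi z0 : ℂ)) + X s * ((a z0 s 0 + X s * B z0 s) / (1 - 2 * X s))

lemma F_mero {z0 : ℝ} (hz : z0 ∈ I) : MeromorphicOn (F z0) {s : ℂ | -(1/10) < s.re} := by
  intro s hs
  have hX : AnalyticAt ℂ X s := X_diff.analyticAt s
  have ha : AnalyticAt ℂ (fun s => a z0 s 0) s := (a_diff 0 z0).analyticAt s
  have hB := B_analytic hz hs
  have hE : AnalyticAt ℂ (fun s : ℂ => Complex.exp (-s/2 * (Phi z0 : ℂ))) s :=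
    Differentiable.analyticAt (by fun_prop) s
  have h1 : MeromorphicAt (fun s => a z0 s 0 + X s * B z0 s) s := (ha.add (hX.mul hB)).meromorphicAt
  have h2 : MeromorphicAt (fun s => 1 - 2 * X s) s :=
    (analyticAt_const.sub (analyticAt_const.mul hX)).meromorphicAt
  exact hE.meromorphicAt.add (hX.meromorphicAt.mul (h1.div h2))

lemma X_lt {s : ℂ} (hs : 2 * Real.log 2 / Real.log 5 < s.re) : 2 * ‖X s‖ < 1 := by
  have h5 : (0:ℝ) < Real.log 5 := Real.log_pos (by norm_num)
  rw [div_lt_iff₀ h5] at hs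
  have : ‖X s‖ < 1/2 := by
    rw [X_norm]
    calc Real.exp (-s.re/2 * Real.log 5) < Real.exp (-Real.log 2) := by
          apply Real.exp_lt_exp.2; linarith
      _ = 1/2 := by rw [Real.exp_neg, Real.exp_log (by norm_num)]; norm_num
  linarith

lemma a_sum {z0 : ℝ} (hz : z0 ∈ I) {s : ℂ} (hs : 2 * Real.log 2 / Real.log 5 < s.re) :
    ∑' m, X s ^ (m+1) * a z0 s m = X s * ((a z0 s 0 + X s * B z0 s) / (1 - 2 * X s)) := by
  have hX := X_lt hs
  have hre : -(1/10) < s.re := by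
    have : 0 < 2 * Real.log 2 / Real.log 5 := by
      have := Real.log_pos (show (1:ℝ) < 2 by norm_num)
      have := Real.log_pos (show (1:ℝ) < 5 by norm_num)
      positivity
    linarith
  have hs1 : Summable (fun m => X s ^ m * a z0 s m) := by
    apply Summable.of_norm_bounded (g := fun m => Real.exp (11 * ‖s‖) * (2 * ‖X s‖)^m)
    · exact (summable_geometric_of_lt_one (by positivity) hX).mul_left _
    · intro m
      rw [norm_mul, norm_pow, mul_pow]
      have := L_bound (G_bound s) m z0 hz
      have h2 : 0 ≤ ‖X s‖^m := by positivity
      rw [a]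
      nlinarith
  have hb := bX_summable hz hre
  have hA : ∑' m, X s ^ m * a z0 s m
      = a z0 s 0 + (2 * X s * ∑' m, X s ^ m * a z0 s m + X s * B z0 s) := by
    rw [B, ← tsum_mul_left, ← tsum_mul_left, ← (hs1.mul_left _).tsum_add (hb.mul_left _)]
    rw [hs1.tsum_eq_zero_add]
    congr 1
    · simp
    · apply tsum_congr
      intro m
      rw [b]; ring
  have hne : 1 - 2 * X s ≠ 0 := by
    intro h
    have : 2 * X s = 1 := by linear_combination -h
    have := congrArg norm this
    rw [norm_mul, norm_one, Complex.norm_ofNat] at this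
    linarith
  simp only [pow_succ']
  simp only [mul_assoc]
  rw [tsum_mul_left]
  congr 1
  rw [eq_div_iff hne]
  linear_combination hA

lemma main_tendsto {z0 : ℝ} (hz : z0 ∈ I) {s : ℂ} (hs : 2 * Real.log 2 / Real.log 5 < s.re) :
    Tendsto (fun n => X s ^ n * L^[n] (E s 0) z0) atTop (nhds (F z0 s)) := by
  have hX := X_lt hs
  simp only [expand, zero_add]
  rw [F, ← a_sum hz hs]
  have hexp : ∀ {u : ℕ → ℝ} {t : ℝ}, Tendsto u atTop (nhds t) →
      Tendsto (fun k => Complex.exp (-s/2 * (u k : ℂ))) atTop (nhds (Complex.exp (-s/2 * (t : ℂ)))) := by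
    intro u t h
    exact (Complex.continuous_exp.tendsto _).comp
      (((Complex.continuous_ofReal.tendsto _).comp h).const_mul _)
  apply Tendsto.add
  · exact hexp (phi_tendsto hz)
  · have hT := tendsto_tsum_of_dominated_convergence (𝓕 := atTop)
      (f := fun n m => if m < n then X s ^ (m+1) *
        L^[m] (fun z => Complex.exp (-s/2 * (f (n-1-m) z : ℂ))) z0 else 0)
      (g := fun m => X s ^ (m+1) * a z0 s m)
      (bound := fun m => (‖X s‖ * Real.exp (11 * ‖s‖)) * (2 * ‖X s‖)^m)
      ((summable_geometric_of_lt_one (by positivity) hX).mul_left _) ?_ ?_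
    · refine hT.congr fun n => ?_
      rw [tsum_eq_sum (s := Finset.range n)]
      · apply Finset.sum_congr rfl
        intro m hm
        rw [if_pos (Finset.mem_range.1 hm)]
      · intro m hm
        rw [if_neg (by simpa using hm)]
    · intro m
      have h1 : Tendsto (fun n : ℕ => n - 1 - m) atTop atTop :=
        (tendsto_sub_atTop_nat m).comp (tendsto_sub_atTop_nat 1)
      have h2 := (L_tendsto (g := fun k z => Complex.exp (-s/2 * (f k z : ℂ))) (h := G s)
        (fun z hz => hexp (f_tendsto hz)) m z0 hz).comp h1
      refine (h2.const_mul (X s ^ (m+1))).congr' ?_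
      filter_upwards [eventually_gt_atTop m] with n hn
      rw [if_pos hn]; rfl
    · refine Eventually.of_forall fun n m => ?_
      split_ifs
      · rw [norm_mul, norm_pow, mul_pow, pow_succ]
        have := L_bound (g := fun z => Complex.exp (-s/2 * (f (n-1-m) z : ℂ)))
          (fun z hz => norm_exp_le s (f_bound _ hz)) m z0 hz
        have h2 : 0 ≤ ‖X s‖^m * ‖X s‖ := by positivity
        nlinarith
      · rw [norm_zero]; positivity

end PZ

/-- Teplyaev's meromorphic continuation: for `z₀ ∈ {3/4, 5/4}`, the polynomial zeta function
`ζ_{R,z₀}(s) = lim_n Σ_{w ∈ {−,+}ⁿ} (5ⁿ z_w)^{-s/2}` (convergent for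
`Re(s) > 2 log 2 / log 5`) extends to a function meromorphic on a half-plane
`{Re(s) > -ε}` for some `ε > 0`. -/
theorem polynomial_zeta_function_meromorphic_continuation
    (z0 : ℝ) (hz0 : z0 ∈ ({3 / 4, 5 / 4} : Set ℝ)) :
    ∃ ε : ℝ, 0 < ε ∧
      ∃ F : ℂ → ℂ, MeromorphicOn F {s : ℂ | -ε < s.re} ∧
        ∀ s : ℂ, 2 * Real.log 2 / Real.log 5 < s.re →
          Tendsto
            (fun n : ℕ => ∑ w : Fin n → Bool,
              (((5 : ℝ) ^ n * preimagePoint z0 (List.ofFn w) : ℝ) : ℂ) ^ (-s / 2))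
            atTop (nhds (F s)) := by
  have hz : z0 ∈ PZ.I := by
    rcases hz0 with h | h
    · rw [h]; constructor <;> norm_num
    · rw [Set.mem_singleton_iff.1 h]; constructor <;> norm_num
  refine ⟨1/10, by norm_num, PZ.F z0, PZ.F_mero hz, fun s hs => ?_⟩
  exact (PZ.main_tendsto hz hs).congr fun n => (PZ.S_eq s hz n).symm
end
end

section
/- Let m_0 be a natural number and let (λ_m)_{m ≥ m_0} be a sequence of real numbers in [0, 25/16] satisfying λ_m = λ_{m+1}(5 − 4 λ_{m+1}) for all m ≥ m_0. Then: (a) the sequence (5^m λ_m)_{m ≥ m_0} is nondecreasing, so its limit exists in [0, +∞]; and (b) this limit is finite if and only if λ_{m+1} ≤ 5/8 for all sufficiently large m, i.e., if and only if λ_{m+1} = (5 − √(25 − 16 λ_m))/8 (the minus inverse branch) for all sufficiently large m. -/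
open Filter

/-- Renormalized eigenvalue limits in the decimation method for the Sierpinski gasket:
if `λ_m ∈ [0, 25/16]` and `λ_m = λ_{m+1}(5 - 4λ_{m+1})` for `m ≥ m₀`, then
(a) `(5^m λ_m)` is nondecreasing for `m ≥ m₀` (so its limit exists in `[0, +∞]`), and
(b) the limit is finite iff eventually `λ_{m+1} ≤ 5/8`, iff eventually `λ_{m+1}` is given
by the minus inverse branch `λ_{m+1} = (5 - √(25 - 16 λ_m))/8`. -/
theorem renormalized_eigenvalue_limit
    (m0 : ℕ) (lam : ℕ → ℝ)
    (hmem : ∀ m, m0 ≤ m → lam m ∈ Set.Icc (0 : ℝ) (25 / 16))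
    (hrec : ∀ m, m0 ≤ m → lam m = lam (m + 1) * (5 - 4 * lam (m + 1))) :
    (∀ m, m0 ≤ m → 5 ^ m * lam m ≤ 5 ^ (m + 1) * lam (m + 1)) ∧
      (∃ L : ENNReal,
        Tendsto (fun m : ℕ => ENNReal.ofReal (5 ^ m * lam m)) atTop (nhds L)) ∧
      ((∃ L : ℝ, Tendsto (fun m : ℕ => 5 ^ m * lam m) atTop (nhds L)) ↔
        ∃ M : ℕ, ∀ m, M ≤ m → lam (m + 1) ≤ 5 / 8) ∧
      ((∃ L : ℝ, Tendsto (fun m : ℕ => 5 ^ m * lam m) atTop (nhds L)) ↔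
        ∃ M : ℕ, ∀ m, M ≤ m →
          lam (m + 1) = (5 - Real.sqrt (25 - 16 * lam m)) / 8) := by
  have hmono : ∀ m, m0 ≤ m → (5:ℝ) ^ m * lam m ≤ 5 ^ (m + 1) * lam (m + 1) := by
    intro m hm
    rw [pow_succ, mul_assoc]
    apply mul_le_mul_of_nonneg_left _ (by positivity)
    rw [hrec m hm]
    nlinarith [sq_nonneg (lam (m + 1))]
  have hmon : ∀ N, m0 ≤ N → Monotone (fun n : ℕ => (5:ℝ) ^ (n + N) * lam (n + N)) := by
    intro N hN
    apply monotone_nat_of_le_succ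
    intro n
    have h := hmono (n + N) (by omega)
    have e : n + 1 + N = n + N + 1 := by omega
    rw [e]
    exact h
  have hbr : ∀ m, m0 ≤ m →
      (lam (m + 1) ≤ 5 / 8 ↔ lam (m + 1) = (5 - Real.sqrt (25 - 16 * lam m)) / 8) := by
    intro m hm
    have e : 25 - 16 * lam m = (5 - 8 * lam (m + 1)) ^ 2 := by
      rw [hrec m hm]; ring
    rw [e, Real.sqrt_sq_eq_abs]
    constructor
    · intro h
      rw [abs_of_nonneg (by linarith)]; ring
    · intro h
      have := abs_nonneg (5 - 8 * lam (m + 1))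
      linarith
  have hfin : (∃ L : ℝ, Tendsto (fun m : ℕ => 5 ^ m * lam m) atTop (nhds L)) ↔
        ∃ M : ℕ, ∀ m, M ≤ m → lam (m + 1) ≤ 5 / 8 := by
    constructor
    · rintro ⟨L, hL⟩
      have h0 : Tendsto (fun m : ℕ => ((1:ℝ) / 5) ^ m) atTop (nhds 0) :=
        tendsto_pow_atTop_nhds_zero_of_lt_one (by norm_num) (by norm_num)
      have h1 := h0.mul hL
      have e : (fun m : ℕ => ((1:ℝ) / 5) ^ m * (5 ^ m * lam m)) = lam := by
        funext m
        rw [← mul_assoc, ← mul_pow]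
        norm_num
      rw [e, zero_mul] at h1
      obtain ⟨M, hM⟩ := eventually_atTop.1
        (h1.eventually (ge_mem_nhds (show (0:ℝ) < 5 / 8 by norm_num)))
      exact ⟨M, fun m hm => hM (m + 1) (by omega)⟩
    · rintro ⟨M, hM⟩
      obtain ⟨N, hNM, hN0⟩ : ∃ N, M ≤ N ∧ m0 ≤ N := ⟨max M m0, le_max_left _ _, le_max_right _ _⟩
      have hanti : ∀ n : ℕ, (5:ℝ) ^ (n + N) * (lam (n + N) * (1 + 16 / 5 * lam (n + N))) ≤
          5 ^ N * (lam N * (1 + 16 / 5 * lam N)) := by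
        intro n
        induction n with
        | zero => simp
        | succ n ih =>
          refine le_trans ?_ ih
          have e : n + 1 + N = n + N + 1 := by omega
          rw [e, pow_succ, mul_assoc]
          apply mul_le_mul_of_nonneg_left _ (by positivity)
          have hx := hM (n + N) (by omega)
          have hx0 := (hmem (n + N + 1) (by omega)).1
          rw [hrec (n + N) (by omega)]
          generalize lam (n + N + 1) = x at *
          have h2 : 0 ≤ (5 - 4 * x) ^ 2 - 25 / 4 := by nlinarith
          nlinarith [mul_nonneg (sq_nonneg x) h2]
      have hbdd : BddAbove (Set.range (fun n : ℕ => (5:ℝ) ^ (n + N) * lam (n + N))) := by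
        refine ⟨5 ^ N * (lam N * (1 + 16 / 5 * lam N)), ?_⟩
        rintro _ ⟨n, rfl⟩
        refine le_trans ?_ (hanti n)
        apply mul_le_mul_of_nonneg_left _ (by positivity)
        nlinarith [sq_nonneg (lam (n + N))]
      exact ⟨_, (tendsto_add_atTop_iff_nat (f := fun m : ℕ => (5:ℝ) ^ m * lam m) N).1
        (tendsto_atTop_ciSup (hmon N hN0) hbdd)⟩
  refine ⟨hmono, ?_, hfin, hfin.trans ?_⟩
  · exact ⟨_, (tendsto_add_atTop_iff_nat
      (f := fun m : ℕ => ENNReal.ofReal ((5:ℝ) ^ m * lam m)) m0).1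
        (tendsto_atTop_iSup (fun a b hab => ENNReal.ofReal_le_ofReal (hmon m0 le_rfl hab)))⟩
  · constructor
    · rintro ⟨M, hM⟩
      exact ⟨max M m0, fun m hm => (hbr m (le_trans (le_max_right _ _) hm)).1
        (hM m (le_trans (le_max_left _ _) hm))⟩
    · rintro ⟨M, hM⟩
      exact ⟨max M m0, fun m hm => (hbr m (le_trans (le_max_right _ _) hm)).2
        (hM m (le_trans (le_max_left _ _) hm))⟩
end

section
/- Let z ∈ ℂ with z ≠ 1, z ≠ −1, and z ≠ −1/2, and set g(z) = z(5 + z) / ((2z + 1)(z + 1)) and v = 3z/(1 − z). Then g(z) ≠ 1 and 3 g(z) / (1 − g(z)) = v(2v + 5). In other words, the Möbius change of variable v = 3z/(1−z) conjugates the rational map g(z) = z(5+z)/((2z+1)(z+1)) into the polynomial p(v) = v(2v + 5). -/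
/-- The Möbius change of variable `v = 3z/(1-z)` conjugates the rational map
`g(z) = z(5+z)/((2z+1)(z+1))` of the infinite Sierpinski lattice into the
Rammal–Toulouse polynomial `p(v) = v(2v+5)`: for admissible `z`, `g(z) ≠ 1` and
`3g(z)/(1 - g(z)) = v(2v+5)`. -/
theorem conjugation_to_Rammal_polynomial (z : ℂ) (h1 : z ≠ 1) (h2 : z ≠ -1)
    (h3 : z ≠ -(1 / 2)) :
    z * (5 + z) / ((2 * z + 1) * (z + 1)) ≠ 1 ∧
      3 * (z * (5 + z) / ((2 * z + 1) * (z + 1))) /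
          (1 - z * (5 + z) / ((2 * z + 1) * (z + 1))) =
        (3 * z / (1 - z)) * (2 * (3 * z / (1 - z)) + 5) := by
  have a : (1 - z) ≠ 0 := sub_ne_zero.mpr (Ne.symm h1)
  have b : z + 1 ≠ 0 := fun h => h2 (by linear_combination h)
  have c : 2 * z + 1 ≠ 0 := fun h => h3 (by linear_combination h / 2)
  have d : (2 * z + 1) * (z + 1) ≠ 0 := mul_ne_zero c b
  have e : 1 - z * (5 + z) / ((2 * z + 1) * (z + 1))
      = (1 - z) ^ 2 / ((2 * z + 1) * (z + 1)) := by
    rw [eq_div_iff d, sub_mul, div_mul_cancel₀ _ d]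
    ring
  refine ⟨fun h => ?_, ?_⟩
  · rw [h, sub_self] at e
    exact div_ne_zero (pow_ne_zero 2 a) d e.symm
  · rw [e, ← mul_div_assoc, div_div_div_cancel_right₀ d]
    field_simp
    ring
end
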